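/- arXiv:2204.08871 — 11 statements merged into one kernel-verified Lean document; each statement's English description precedes it below -/
import Mathlib

section
/- Let Z be a nonnegative-integer-valued random variable with probability mass function p and probability generating function Q(w) = ∑_{n=0}^∞ p_n w^n, and let 0 < r < 1. Then the r-th absolute moment ∑_{n=1}^∞ p_n n^r is finite if and only if ∫_0^1 (1-Q(w)) / ((-log w)^{1+r} · w) dw < ∞; moreover, in that case ∑_{n=1}^∞ p_n n^r = (1/(-Γ(-r))) · ∫_0^1 (1-Q(w)) / ((-log w)^{1+r} · w) dw, where Γ is the Gamma function (note -Γ(-r) > 0 for 0 < r < 1). -/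
open MeasureTheory Set Filter Topology

/-- The integrand `(1 - e^{-ax}) x^{-1-r}` is integrable on `(0, ∞)` for `0 < r < 1`. -/
lemma integrableOn_one_sub_exp_mul_rpow {a r : ℝ} (ha : 0 < a) (hr : 0 < r) (hr1 : r < 1) :
    IntegrableOn (fun x : ℝ => (1 - Real.exp (-(a * x))) * x ^ (-1 - r)) (Ioi 0) := by
  have hmeas : Measurable (fun x : ℝ => (1 - Real.exp (-(a * x))) * x ^ (-1 - r)) := by
    fun_prop
  have hnonneg : ∀ x : ℝ, 0 < x → 0 ≤ 1 - Real.exp (-(a * x)) := fun x hx => by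
    have : Real.exp (-(a * x)) ≤ 1 := Real.exp_le_one_iff.2 (by nlinarith)
    linarith
  rw [← Ioc_union_Ioi_eq_Ioi zero_le_one]
  refine IntegrableOn.union ?_ ?_
  · have hg : IntegrableOn (fun x : ℝ => a * x ^ (-r)) (Ioc 0 1) := by
      have := (intervalIntegral.intervalIntegrable_rpow' (a := 0) (b := 1)
        (by linarith : -1 < -r)).const_mul a
      rwa [intervalIntegrable_iff_integrableOn_Ioc_of_le zero_le_one] at this
    refine hg.mono' hmeas.aestronglyMeasurable ?_
    refine (ae_restrict_iff' measurableSet_Ioc).2 (ae_of_all _ fun x hx => ?_)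
    have hx0 : 0 < x := hx.1
    rw [Real.norm_of_nonneg (mul_nonneg (hnonneg x hx0) (Real.rpow_nonneg hx0.le _))]
    have h1 : 1 - Real.exp (-(a * x)) ≤ a * x := by
      have := Real.add_one_le_exp (-(a * x))
      linarith
    calc (1 - Real.exp (-(a * x))) * x ^ (-1 - r) ≤ (a * x) * x ^ (-1 - r) := by gcongr
      _ = a * (x ^ (-1 - r) * x) := by ring
      _ = a * x ^ (-r) := by rw [← Real.rpow_add_one hx0.ne']; ring_nf
  · refine (integrableOn_Ioi_rpow_of_lt (by linarith : -1 - r < -1) zero_lt_one).mono'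
      hmeas.aestronglyMeasurable ?_
    refine (ae_restrict_iff' measurableSet_Ioi).2 (ae_of_all _ fun x hx => ?_)
    have hx0 : 0 < x := zero_lt_one.trans hx
    rw [Real.norm_of_nonneg (mul_nonneg (hnonneg x hx0) (Real.rpow_nonneg hx0.le _))]
    refine mul_le_of_le_one_left (Real.rpow_nonneg hx0.le _) ?_
    linarith [Real.exp_pos (-(a * x))]

/-- `-Γ(-r) = Γ(1 - r) / r`. -/
lemma neg_Gamma_neg {r : ℝ} (hr : r ≠ 0) : -Real.Gamma (-r) = Real.Gamma (1 - r) / r := by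
  have h := Real.Gamma_add_one (neg_ne_zero.2 hr)
  rw [show 1 - r = -r + 1 by ring, h]
  field_simp

lemma neg_Gamma_neg_pos {r : ℝ} (hr : 0 < r) (hr1 : r < 1) : 0 < -Real.Gamma (-r) := by
  rw [neg_Gamma_neg hr.ne']
  exact div_pos (Real.Gamma_pos_of_pos (by linarith)) hr

lemma integral_one_sub_exp_mul_rpow {a r : ℝ} (ha : 0 < a) (hr : 0 < r) (hr1 : r < 1) :
    ∫ x in Ioi (0 : ℝ), (1 - Real.exp (-(a * x))) * x ^ (-1 - r) =
      -Real.Gamma (-r) * a ^ r := by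
  have hf := integrableOn_one_sub_exp_mul_rpow ha hr hr1
  have hval := Real.integral_rpow_mul_exp_neg_mul_Ioi (by linarith : 0 < 1 - r) ha
  have hg : IntegrableOn (fun x : ℝ => a / r * (x ^ (1 - r - 1) * Real.exp (-(a * x))))
      (Ioi 0) := by
    refine Integrable.const_mul ?_ _
    by_contra hcon
    rw [integral_undef hcon] at hval
    have : 0 < (1 / a) ^ (1 - r) * Real.Gamma (1 - r) :=
      mul_pos (Real.rpow_pos_of_pos (by positivity) _) (Real.Gamma_pos_of_pos (by linarith))
    linarith
  have hderiv : ∀ x ∈ Ioi (0 : ℝ), HasDerivAt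
      (fun x : ℝ => -((1 - Real.exp (-(a * x))) * x ^ (-r)) / r)
      ((1 - Real.exp (-(a * x))) * x ^ (-1 - r) -
        a / r * (x ^ (1 - r - 1) * Real.exp (-(a * x)))) x := fun x hx => by
    have h1 : HasDerivAt (fun x : ℝ => 1 - Real.exp (-(a * x)))
        (-(Real.exp (-(a * x)) * (-(a * 1)))) x :=
      (((hasDerivAt_id x).const_mul a).neg.exp).const_sub 1
    have h2 := Real.hasDerivAt_rpow_const (x := x) (p := -r) (Or.inl (ne_of_gt hx))
    refine ((h1.mul h2).neg.div_const r).congr_deriv ?_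
    rw [show -r - 1 = -1 - r by ring, show 1 - r - 1 = -r by ring]
    field_simp
    ring
  have hnonneg : ∀ x : ℝ, 0 ≤ x → 0 ≤ 1 - Real.exp (-(a * x)) := fun x hx => by
    have : Real.exp (-(a * x)) ≤ 1 := Real.exp_le_one_iff.2 (by nlinarith)
    linarith
  have hcont : ContinuousWithinAt
      (fun x : ℝ => -((1 - Real.exp (-(a * x))) * x ^ (-r)) / r) (Ici 0) 0 := by
    have hlim : Tendsto (fun x : ℝ => (1 - Real.exp (-(a * x))) * x ^ (-r))
        (𝓝[Ici 0] 0) (𝓝 0) := by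
      have hup : Tendsto (fun x : ℝ => a * x ^ (1 - r)) (𝓝[Ici 0] 0) (𝓝 0) := by
        have := ((Real.continuousAt_rpow_const 0 (1 - r)
          (Or.inr (by linarith))).tendsto.const_mul a).mono_left
            (nhdsWithin_le_nhds (s := Ici 0))
        rwa [Real.zero_rpow (by linarith), mul_zero] at this
      refine tendsto_of_tendsto_of_tendsto_of_le_of_le' tendsto_const_nhds hup ?_ ?_
      · filter_upwards [self_mem_nhdsWithin] with x hx
        exact mul_nonneg (hnonneg x hx) (Real.rpow_nonneg hx _)
      · filter_upwards [self_mem_nhdsWithin] with x hx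
        rcases eq_or_lt_of_le (show 0 ≤ x from hx) with rfl | hx0
        · simp only [mul_zero, neg_zero, Real.exp_zero, sub_self, zero_mul]
          positivity
        · have h1 : 1 - Real.exp (-(a * x)) ≤ a * x := by
            have := Real.add_one_le_exp (-(a * x))
            linarith
          calc (1 - Real.exp (-(a * x))) * x ^ (-r) ≤ (a * x) * x ^ (-r) := by gcongr
            _ = a * (x ^ (-r) * x) := by ring
            _ = a * x ^ (1 - r) := by rw [← Real.rpow_add_one hx0.ne']; ring_nf
    have := (hlim.neg).div_const r
    simpa [ContinuousWithinAt] using this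
  have hinf : Tendsto (fun x : ℝ => -((1 - Real.exp (-(a * x))) * x ^ (-r)) / r)
      atTop (𝓝 0) := by
    have hlim : Tendsto (fun x : ℝ => (1 - Real.exp (-(a * x))) * x ^ (-r)) atTop (𝓝 0) := by
      refine tendsto_of_tendsto_of_tendsto_of_le_of_le' tendsto_const_nhds
        (tendsto_rpow_neg_atTop hr) ?_ ?_
      · filter_upwards [eventually_ge_atTop 0] with x hx
        exact mul_nonneg (hnonneg x hx) (Real.rpow_nonneg hx _)
      · filter_upwards [eventually_ge_atTop 0] with x hx
        refine mul_le_of_le_one_left (Real.rpow_nonneg hx _) ?_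
        linarith [Real.exp_pos (-(a * x))]
    simpa using (hlim.neg).div_const r
  have key := integral_Ioi_of_hasDerivAt_of_tendsto hcont hderiv (hf.sub hg) hinf
  rw [integral_sub hf hg, integral_const_mul, hval] at key
  simp only [mul_zero, neg_zero, Real.exp_zero, sub_self, zero_mul, zero_div] at key
  rw [sub_eq_zero.1 key, neg_Gamma_neg hr.ne', one_div, Real.inv_rpow ha.le,
    ← Real.rpow_neg ha.le, show -(1 - r) = r - 1 by ring, Real.rpow_sub_one ha.ne']
  field_simp

lemma image_exp_neg_Ioi : (fun x : ℝ => Real.exp (-x)) '' Ioi 0 = Ioo 0 1 := by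
  ext w
  constructor
  · rintro ⟨x, hx, rfl⟩
    exact ⟨Real.exp_pos _, Real.exp_lt_one_iff.2 (neg_lt_zero.2 hx)⟩
  · rintro ⟨h0, h1⟩
    exact ⟨-Real.log w, neg_pos.2 (Real.log_neg h0 h1), by simp [Real.exp_log h0]⟩

lemma lintegral_one_sub_pow (n : ℕ) {r : ℝ} (hr : 0 < r) (hr1 : r < 1) :
    ∫⁻ w in Ioo (0 : ℝ) 1, ENNReal.ofReal ((1 - w ^ n) / ((-Real.log w) ^ (1 + r) * w)) =
      ENNReal.ofReal (-Real.Gamma (-r) * (n : ℝ) ^ r) := by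
  rcases Nat.eq_zero_or_pos n with rfl | hn
  · simp [Real.zero_rpow hr.ne']
  have ha : (0 : ℝ) < n := Nat.cast_pos.2 hn
  have hd : ∀ x ∈ Ioi (0 : ℝ), HasDerivWithinAt (fun x : ℝ => Real.exp (-x))
      (Real.exp (-x) * (-1)) (Ioi 0) x := fun x _ =>
    ((hasDerivAt_id x).neg.exp).hasDerivWithinAt
  rw [← integral_one_sub_exp_mul_rpow ha hr hr1, ofReal_integral_eq_lintegral_ofReal
    (integrableOn_one_sub_exp_mul_rpow ha hr hr1), ← image_exp_neg_Ioi,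
    lintegral_image_eq_lintegral_abs_deriv_mul measurableSet_Ioi hd
      (fun x _ y _ h => neg_injective (Real.exp_injective h))]
  · refine setLIntegral_congr_fun measurableSet_Ioi fun x hx => ?_
    have hx0 : 0 < x := hx
    rw [← ENNReal.ofReal_mul (abs_nonneg _)]
    congr 1
    rw [mul_neg_one, abs_neg, abs_of_pos (Real.exp_pos _), Real.log_exp, neg_neg,
      ← Real.exp_nat_mul, show -1 - r = -(1 + r) by ring, Real.rpow_neg hx0.le, mul_neg]
    have := Real.exp_pos (-x)
    have := Real.rpow_pos_of_pos hx0 (1 + r)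
    field_simp
  · refine (ae_restrict_iff' measurableSet_Ioi).2 (ae_of_all _ fun x hx => ?_)
    have hx0 : 0 < x := hx
    have : Real.exp (-(n * x)) ≤ 1 := Real.exp_le_one_iff.2 (by nlinarith)
    exact mul_nonneg (by linarith) (Real.rpow_nonneg hx0.le _)

/-- Finiteness and value of the `r`-th absolute moment (`0 < r < 1`) of a
nonnegative-integer random variable in terms of its pgf. -/
theorem stmt_4 (p : ℕ → ℝ) (hp : ∀ n, 0 ≤ p n) (hp1 : ∑' n, p n = 1)
    (r : ℝ) (hr : 0 < r) (hr1 : r < 1)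
    (Q : ℝ → ℝ) (hQ : ∀ w, Q w = ∑' n : ℕ, p n * w ^ n) :
    ((∑' n : ℕ, ENNReal.ofReal (p n * (n : ℝ) ^ r)) < ⊤ ↔
      (∫⁻ w in Set.Ioo (0:ℝ) 1,
        ENNReal.ofReal ((1 - Q w) / ((-Real.log w) ^ (1 + r) * w))) < ⊤) ∧
    ((∑' n : ℕ, ENNReal.ofReal (p n * (n : ℝ) ^ r)) < ⊤ →
      ∑' n : ℕ, p n * (n : ℝ) ^ r =
        (1 / (-Real.Gamma (-r))) *
          ∫ w in Set.Ioo (0:ℝ) 1, (1 - Q w) / ((-Real.log w) ^ (1 + r) * w)) := by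
  have hps : Summable p := by
    by_contra h
    rw [tsum_eq_zero_of_not_summable h] at hp1
    exact zero_ne_one hp1
  have hC := neg_Gamma_neg_pos hr hr1
  set T : ℕ → ℝ → ENNReal := fun n w =>
    ENNReal.ofReal (p n) * ENNReal.ofReal ((1 - w ^ n) / ((-Real.log w) ^ (1 + r) * w)) with hT
  have hTmeas : ∀ n, Measurable (T n) := fun n => by fun_prop
  have hden : ∀ w ∈ Ioo (0 : ℝ) 1, 0 ≤ (-Real.log w) ^ (1 + r) * w := fun w hw =>
    mul_nonneg (Real.rpow_nonneg (neg_pos.2 (Real.log_neg hw.1 hw.2)).le _) hw.1.le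
  have hterm : ∀ w ∈ Ioo (0 : ℝ) 1, ∀ n,
      0 ≤ (1 - w ^ n) / ((-Real.log w) ^ (1 + r) * w) := fun w hw n =>
    div_nonneg (sub_nonneg.2 (pow_le_one₀ hw.1.le hw.2.le)) (hden w hw)
  have hsum : ∀ w ∈ Ioo (0 : ℝ) 1, HasSum
      (fun n => p n * ((1 - w ^ n) / ((-Real.log w) ^ (1 + r) * w)))
      ((1 - Q w) / ((-Real.log w) ^ (1 + r) * w)) := fun w hw => by
    have hpw : Summable (fun n => p n * w ^ n) :=
      hps.of_nonneg_of_le (fun n => mul_nonneg (hp n) (pow_nonneg hw.1.le _))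
        (fun n => mul_le_of_le_one_right (hp n) (pow_le_one₀ hw.1.le hw.2.le))
    have h := ((hps.hasSum.sub hpw.hasSum).div_const ((-Real.log w) ^ (1 + r) * w))
    rw [hp1, ← hQ] at h
    exact h.congr_fun fun n => by ring
  have hpt : ∀ w ∈ Ioo (0 : ℝ) 1,
      ENNReal.ofReal ((1 - Q w) / ((-Real.log w) ^ (1 + r) * w)) = ∑' n, T n w := fun w hw => by
    rw [← (hsum w hw).tsum_eq, ENNReal.ofReal_tsum_of_nonneg
      (fun n => mul_nonneg (hp n) (hterm w hw n)) (hsum w hw).summable]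
    exact tsum_congr fun n => ENNReal.ofReal_mul (hp n)
  have hint : ∫⁻ w in Ioo (0 : ℝ) 1, ∑' n, T n w =
      ENNReal.ofReal (-Real.Gamma (-r)) * ∑' n : ℕ, ENNReal.ofReal (p n * (n : ℝ) ^ r) := by
    rw [lintegral_tsum fun n => (hTmeas n).aemeasurable, ← ENNReal.tsum_mul_left]
    refine tsum_congr fun n => ?_
    rw [hT, lintegral_const_mul _ (by fun_prop), lintegral_one_sub_pow n hr hr1,
      ← ENNReal.ofReal_mul (hp n), ← ENNReal.ofReal_mul hC.le]
    congr 1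
    ring
  have hC0 : ENNReal.ofReal (-Real.Gamma (-r)) ≠ 0 := (ENNReal.ofReal_pos.2 hC).ne'
  refine ⟨?_, fun _ => ?_⟩
  · rw [setLIntegral_congr_fun measurableSet_Ioo hpt, hint, ENNReal.mul_lt_top_iff]
    constructor
    · exact fun h => Or.inl ⟨ENNReal.ofReal_lt_top, h⟩
    · rintro (h | h | h)
      · exact h.2
      · exact absurd h hC0
      · simp [h]
  · have hreal : ∫ w in Ioo (0 : ℝ) 1, (1 - Q w) / ((-Real.log w) ^ (1 + r) * w) =
        ∫ w in Ioo (0 : ℝ) 1, (∑' n, T n w).toReal :=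
      setIntegral_congr_fun measurableSet_Ioo fun w hw => by
        rw [← hpt w hw, ENNReal.toReal_ofReal]
        exact (hsum w hw).nonneg fun n => mul_nonneg (hp n) (hterm w hw n)
    rw [hreal, integral_toReal (Measurable.tsum hTmeas).aemeasurable, hint,
      ENNReal.toReal_mul, ENNReal.toReal_ofReal hC.le,
      ENNReal.tsum_toReal_eq fun n => ENNReal.ofReal_ne_top, ← mul_assoc,
      one_div_mul_cancel hC.ne', one_mul]
    · exact tsum_congr fun n =>
        (ENNReal.toReal_ofReal (mul_nonneg (hp n) (Real.rpow_nonneg n.cast_nonneg _))).symm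
    · refine (ae_restrict_iff' measurableSet_Ioo).2 (ae_of_all _ fun w hw => ?_)
      rw [← hpt w hw]
      exact ENNReal.ofReal_lt_top
end

section
/- Let Q be a self-decomposable probability generating function and let γ ∈ (0,1). Then the composition G(w) = Q(S(γ,w)) = Q(1-(1-w)^γ) is again a probability generating function and is self-decomposable: for every a ∈ (0,1) there exists a probability mass function h (depending on a) with G(w) = G(1-a(1-w)) · ∑_{m=0}^∞ h_m w^m for all w ∈ [0,1]. -/
open Filter Topology

/-- `Q` agrees on `[0, 1]` with the generating function of a probability mass function on `ℕ`. -/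
def IsPGF (Q : ℝ → ℝ) : Prop :=
  ∃ p : ℕ → ℝ, (∀ n, 0 ≤ p n) ∧ (∑' n, p n = 1) ∧
    ∀ w ∈ Set.Icc (0:ℝ) 1, Q w = ∑' n : ℕ, p n * w ^ n

theorem hasSum_of_tsum_eq_one {p : ℕ → ℝ} (h : ∑' n, p n = 1) : HasSum p 1 := by
  by_cases hs : Summable p
  · exact h ▸ hs.hasSum
  · simp [tsum_eq_zero_of_not_summable hs] at h

theorem summable_mul_pow_of_summable {p : ℕ → ℝ} (hp : ∀ n, 0 ≤ p n) (hs : Summable p)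
    {w : ℝ} (hw : w ∈ Set.Icc (0:ℝ) 1) : Summable fun n => p n * w ^ n :=
  hs.of_nonneg_of_le (fun n => mul_nonneg (hp n) (pow_nonneg hw.1 n))
    fun n => mul_le_of_le_one_right (hp n) (pow_le_one₀ hw.1 hw.2)

theorem IsPGF.exists_hasSum {Q : ℝ → ℝ} (hQ : IsPGF Q) :
    ∃ p : ℕ → ℝ, (∀ n, 0 ≤ p n) ∧ HasSum p 1 ∧
      ∀ w ∈ Set.Icc (0:ℝ) 1, HasSum (fun n => p n * w ^ n) (Q w) := by
  obtain ⟨p, hp, h1, hw⟩ := hQ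
  have hs := hasSum_of_tsum_eq_one h1
  exact ⟨p, hp, hs, fun w h => hw w h ▸ (summable_mul_pow_of_summable hp hs.summable h).hasSum⟩

theorem IsPGF.mem_Icc {Q : ℝ → ℝ} (hQ : IsPGF Q) {w : ℝ} (hw : w ∈ Set.Icc (0:ℝ) 1) :
    Q w ∈ Set.Icc (0:ℝ) 1 := by
  obtain ⟨p, hp, h1, h⟩ := hQ.exists_hasSum
  exact ⟨(h w hw).nonneg fun n => mul_nonneg (hp n) (pow_nonneg hw.1 n),
    hasSum_le (fun n => mul_le_of_le_one_right (hp n) (pow_le_one₀ hw.1 hw.2)) (h w hw) h1⟩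

theorem IsPGF.one : IsPGF fun _ => 1 := by
  refine ⟨fun n => if n = 0 then 1 else 0, fun n => by positivity, by simp, fun w _ => ?_⟩
  simp [ite_mul]

theorem hasSum_antidiagonal_of_nonneg {f g : ℕ → ℝ} {a b : ℝ} (hf : ∀ n, 0 ≤ f n)
    (hg : ∀ n, 0 ≤ g n) (ha : HasSum f a) (hb : HasSum g b) :
    HasSum (fun n => ∑ kl ∈ Finset.HasAntidiagonal.antidiagonal n, f kl.1 * g kl.2) (a * b) := by
  have h := ha.summable.mul_of_nonneg hb.summable hf hg
  rw [← ha.tsum_eq, ← hb.tsum_eq,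
    ha.summable.tsum_mul_tsum_eq_tsum_sum_antidiagonal hb.summable h]
  exact (summable_sum_mul_antidiagonal_of_summable_mul h).hasSum

theorem IsPGF.mul {Q R : ℝ → ℝ} (hQ : IsPGF Q) (hR : IsPGF R) : IsPGF fun w => Q w * R w := by
  obtain ⟨p, hp, hp1, hpw⟩ := hQ.exists_hasSum
  obtain ⟨q, hq, hq1, hqw⟩ := hR.exists_hasSum
  refine ⟨fun n => ∑ kl ∈ Finset.HasAntidiagonal.antidiagonal n, p kl.1 * q kl.2,
    fun n => Finset.sum_nonneg fun kl _ => mul_nonneg (hp _) (hq _), ?_, fun w hw => ?_⟩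
  · simpa using (hasSum_antidiagonal_of_nonneg hp hq hp1 hq1).tsum_eq
  · beta_reduce
    rw [← (hasSum_antidiagonal_of_nonneg (fun n => mul_nonneg (hp n) (pow_nonneg hw.1 n))
      (fun n => mul_nonneg (hq n) (pow_nonneg hw.1 n)) (hpw w hw) (hqw w hw)).tsum_eq]
    refine tsum_congr fun n => ?_
    rw [Finset.sum_mul]
    refine Finset.sum_congr rfl fun kl hkl => ?_
    rw [← Finset.HasAntidiagonal.mem_antidiagonal.1 hkl, pow_add]
    ring

theorem IsPGF.pow {Q : ℝ → ℝ} (hQ : IsPGF Q) (n : ℕ) : IsPGF fun w => Q w ^ n := by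
  induction n with
  | zero => simpa using IsPGF.one
  | succ n ih => simpa only [pow_succ] using ih.mul hQ

theorem hasSum_tsum_swap_of_nonneg {f : ℕ → ℕ → ℝ} {a : ℕ → ℝ} {A : ℝ} (hf : ∀ n m, 0 ≤ f n m)
    (ha : ∀ n, HasSum (f n) (a n)) (hA : HasSum a A) :
    HasSum (fun m => ∑' n, f n m) A := by
  have hs : Summable fun x : ℕ × ℕ => f x.1 x.2 :=
    (summable_prod_of_nonneg fun x => hf x.1 x.2).2
      ⟨fun n => (ha n).summable, by simpa only [(ha _).tsum_eq] using hA.summable⟩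
  have hA' : HasSum (fun x : ℕ × ℕ => f x.1 x.2) A := by
    rw [hA.unique (hs.hasSum.prod_fiberwise ha)]
    exact hs.hasSum
  have hsw : HasSum (fun x : ℕ × ℕ => f x.2 x.1) A := (Equiv.prodComm ℕ ℕ).hasSum_iff.2 hA'
  exact hsw.prod_fiberwise fun m => (hsw.summable.prod_factor m).hasSum

theorem IsPGF.comp {Q R : ℝ → ℝ} (hQ : IsPGF Q) (hR : IsPGF R) : IsPGF fun w => Q (R w) := by
  obtain ⟨p, hp, hp1, hpw⟩ := hQ.exists_hasSum
  choose c hc hc1 hcw using fun n => (hR.pow n).exists_hasSum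
  refine ⟨fun m => ∑' n, p n * c n m, fun m => tsum_nonneg fun n => mul_nonneg (hp n) (hc n m),
    (hasSum_tsum_swap_of_nonneg (fun n m => mul_nonneg (hp n) (hc n m))
      (fun n => by simpa using (hc1 n).mul_left (p n)) hp1).tsum_eq, fun w hw => ?_⟩
  beta_reduce
  rw [← (hasSum_tsum_swap_of_nonneg
    (fun n m => mul_nonneg (hp n) (mul_nonneg (hc n m) (pow_nonneg hw.1 m)))
    (fun n => (hcw n w hw).mul_left (p n)) (hpw _ (hR.mem_Icc hw))).tsum_eq]
  refine tsum_congr fun m => ?_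
  rw [← tsum_mul_right]
  exact tsum_congr fun n => (mul_assoc _ _ _).symm

theorem neg_one_pow_mul_choose_succ_nonneg {γ : ℝ} (hγ : γ ∈ Set.Ioo (0:ℝ) 1) (n : ℕ) :
    0 ≤ (-1) ^ n * Ring.choose γ (n + 1) := by
  have key : 0 ≤ (-1) ^ n * (descPochhammer ℤ (n + 1)).smeval γ := by
    induction n with
    | zero => simpa using hγ.1.le
    | succ n ih =>
      rw [descPochhammer_succ_right, Polynomial.smeval_mul]
      have h : 0 ≤ (n : ℝ) + 1 - γ := by linarith [hγ.2, n.cast_nonneg (α := ℝ)]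
      refine (mul_nonneg ih h).trans_eq ?_
      simp [Polynomial.smeval_sub, Polynomial.smeval_natCast]
      ring
  rw [Ring.choose_eq_smul, smul_eq_mul, mul_left_comm]
  exact mul_nonneg (by positivity) key

theorem hasSum_one_sub_rpow {γ w : ℝ} (hw : w ∈ Set.Ico (0:ℝ) 1) :
    HasSum (fun n => (-1) ^ n * Ring.choose γ n * w ^ n) ((1 - w) ^ γ) := by
  have h := (Real.one_add_rpow_hasFPowerSeriesOnBall_zero (a := γ)).hasSum (y := -w) (by
    rw [← ENNReal.ofReal_one, Metric.eball_ofReal]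
    simpa [abs_of_nonneg hw.1] using hw.2)
  rw [zero_add, ← sub_eq_add_neg] at h
  refine h.congr_fun fun n => ?_
  simp only [binomialSeries_apply, List.ofFn_const, List.prod_replicate, smul_eq_mul, neg_pow w]
  ring

/-- A power series with nonnegative coefficients that converges on `[0, 1)` to a function tending
to `1` at `1` is a probability generating function. -/
theorem isPGF_of_tendsto {Q : ℝ → ℝ} {p : ℕ → ℝ} (hp : ∀ n, 0 ≤ p n)
    (hQ : ∀ w ∈ Set.Ico (0:ℝ) 1, HasSum (fun n => p n * w ^ n) (Q w)) (hQ1 : Q 1 = 1)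
    (hlim : Tendsto Q (𝓝[<] 1) (𝓝 1)) : IsPGF Q := by
  have hev : ∀ᶠ w : ℝ in 𝓝[<] 1, w ∈ Set.Ico (0:ℝ) 1 := Ico_mem_nhdsLT one_pos
  have hs : Summable p := by
    refine summable_of_sum_range_le (c := 1) hp fun N => ?_
    have hc : Continuous fun w : ℝ => ∑ n ∈ Finset.range N, p n * w ^ n := by fun_prop
    have ht := (hc.tendsto 1).mono_left (nhdsWithin_le_nhds (s := Set.Iio 1))
    simp only [one_pow, mul_one] at ht
    refine le_of_tendsto_of_tendsto ht hlim ?_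
    filter_upwards [hev] with w hw
    exact sum_le_hasSum _ (fun n _ => mul_nonneg (hp n) (pow_nonneg hw.1 n)) (hQ w hw)
  have h1 : ∑' n, p n = 1 := by
    refine tendsto_nhds_unique
      (Real.tendsto_tsum_powerSeries_nhdsWithin_lt hs.hasSum.tendsto_sum_nat) (hlim.congr' ?_)
    filter_upwards [hev] with w hw
    exact (hQ w hw).tsum_eq.symm
  refine ⟨p, hp, h1, fun w hw => ?_⟩
  rcases hw.2.eq_or_lt with rfl | hlt
  · simp [hQ1, h1]
  · exact (hQ w ⟨hw.1, hlt⟩).tsum_eq.symm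

theorem isPGF_sibuya {γ : ℝ} (hγ : γ ∈ Set.Ioo (0:ℝ) 1) : IsPGF fun w => 1 - (1 - w) ^ γ := by
  refine isPGF_of_tendsto
    (p := fun n => (if n = 0 then 1 else 0) - (-1) ^ n * Ring.choose γ n) ?_ ?_ ?_ ?_
  · rintro (_ | n)
    · simp
    · simpa [pow_succ] using neg_one_pow_mul_choose_succ_nonneg hγ n
  · intro w hw
    refine ((hasSum_ite_eq 0 (1:ℝ)).sub (hasSum_one_sub_rpow (γ := γ) hw)).congr_fun fun n => ?_
    rcases n with _ | n <;> simp
  · simp [Real.zero_rpow hγ.1.ne']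
  · have hc : Continuous fun w : ℝ => 1 - (1 - w) ^ γ :=
      continuous_const.sub ((continuous_const.sub continuous_id).rpow_const fun _ => .inr hγ.1.le)
    simpa [Real.zero_rpow hγ.1.ne'] using (hc.tendsto 1).mono_left nhdsWithin_le_nhds


/-- Composing a self-decomposable pgf with the Sibuya pgf `S(γ,w) = 1-(1-w)^γ`
yields a self-decomposable pgf. -/
theorem stmt_5 (Q : ℝ → ℝ)
    (hQpgf : ∃ p : ℕ → ℝ, (∀ n, 0 ≤ p n) ∧ (∑' n, p n = 1) ∧
      ∀ w ∈ Set.Icc (0:ℝ) 1, Q w = ∑' n : ℕ, p n * w ^ n)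
    (hQsd : ∀ a ∈ Set.Ioo (0:ℝ) 1, ∃ h : ℕ → ℝ, (∀ m, 0 ≤ h m) ∧ (∑' m, h m = 1) ∧
      ∀ w ∈ Set.Icc (0:ℝ) 1, Q w = Q (1 - a * (1 - w)) * ∑' m : ℕ, h m * w ^ m)
    (γ : ℝ) (hγ : γ ∈ Set.Ioo (0:ℝ) 1)
    (G : ℝ → ℝ) (hG : ∀ w, G w = Q (1 - (1 - w) ^ γ)) :
    (∃ g : ℕ → ℝ, (∀ n, 0 ≤ g n) ∧ (∑' n, g n = 1) ∧
      ∀ w ∈ Set.Icc (0:ℝ) 1, G w = ∑' n : ℕ, g n * w ^ n) ∧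
    (∀ a ∈ Set.Ioo (0:ℝ) 1, ∃ h : ℕ → ℝ, (∀ m, 0 ≤ h m) ∧ (∑' m, h m = 1) ∧
      ∀ w ∈ Set.Icc (0:ℝ) 1, G w = G (1 - a * (1 - w)) * ∑' m : ℕ, h m * w ^ m) := by
  obtain rfl : G = fun w => Q (1 - (1 - w) ^ γ) := funext hG
  have hS := isPGF_sibuya hγ
  refine ⟨IsPGF.comp hQpgf hS, fun a ha => ?_⟩
  obtain ⟨h, hh, hh1, hhw⟩ := hQsd (a ^ γ)
    ⟨Real.rpow_pos_of_pos ha.1 γ, Real.rpow_lt_one ha.1.le ha.2 hγ.1⟩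
  have hH : IsPGF fun w => ∑' m, h m * w ^ m := ⟨h, hh, hh1, fun _ _ => rfl⟩
  obtain ⟨k, hk, hk1, hkw⟩ := hH.comp hS
  refine ⟨k, hk, hk1, fun w hw => ?_⟩
  rw [← hkw w hw]
  simpa only [sub_sub_cancel, Real.mul_rpow ha.1.le (sub_nonneg.2 hw.2)] using
    hhw _ (hS.mem_Icc hw)
end

section
/- Let 0 < α < 1 and 0 < γ < 1, and define Q(w) = S(αγ,w)/S(γ,w) = (1-(1-w)^{αγ})/(1-(1-w)^γ) for w ∈ (0,1], extended by Q(0) = α. Then Q is a probability generating function and is self-decomposable: there is a probability mass function q with Q(w) = ∑_{n=0}^∞ q_n w^n on [0,1], and for every a ∈ (0,1) there exists a probability mass function h with Q(w) = Q(1-a(1-w)) · ∑_{m=0}^∞ h_m w^m for all w ∈ [0,1]. Equivalently, a Sibuya random variable with parameter αγ is distributed as the independent sum of a Sibuya random variable with parameter γ and a self-decomposable random variable. -/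
open Set Filter Topology
open Finset.HasAntidiagonal (antidiagonal mem_antidiagonal)

/-- `f` agrees on `[0, 1)` with a convergent power series with nonnegative coefficients. -/
def HasNonnegPowerSeries (f : ℝ → ℝ) : Prop :=
  ∃ a : ℕ → ℝ, (∀ n, 0 ≤ a n) ∧ ∀ w ∈ Ico (0 : ℝ) 1, HasSum (fun n => a n * w ^ n) (f w)

namespace HasNonnegPowerSeries

variable {f g : ℝ → ℝ}

lemma congr (hf : HasNonnegPowerSeries f) (h : ∀ w ∈ Ico (0 : ℝ) 1, g w = f w) :
    HasNonnegPowerSeries g := by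
  obtain ⟨a, ha, hs⟩ := hf
  exact ⟨a, ha, fun w hw => h w hw ▸ hs w hw⟩

lemma const {c : ℝ} (hc : 0 ≤ c) : HasNonnegPowerSeries fun _ => c := by
  refine ⟨fun n => if n = 0 then c else 0, fun n => by dsimp only; split_ifs <;> simp [hc],
    fun w _ => ?_⟩
  convert! hasSum_single (f := fun n => (if n = 0 then c else 0) * w ^ n) 0 ?_ using 1
  · simp
  · intro n hn
    simp [hn]

lemma hasSum {f : ℕ → ℝ → ℝ} (hf : ∀ i, HasNonnegPowerSeries (f i))
    (hg : ∀ w ∈ Ico (0 : ℝ) 1, HasSum (fun i => f i w) (g w)) : HasNonnegPowerSeries g := by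
  choose a ha hs using hf
  refine ⟨fun n => ∑' i, a i n, fun n => tsum_nonneg fun i => ha i n, fun w hw => ?_⟩
  have hnn : 0 ≤ fun p : ℕ × ℕ => a p.1 p.2 * w ^ p.2 := fun p =>
    mul_nonneg (ha _ _) (pow_nonneg hw.1 _)
  have hsum : Summable fun p : ℕ × ℕ => a p.1 p.2 * w ^ p.2 := by
    rw [summable_prod_of_nonneg hnn]
    refine ⟨fun i => (hs i w hw).summable, ?_⟩
    simpa only [(hs _ w hw).tsum_eq] using (hg w hw).summable
  have htot : HasSum (fun p : ℕ × ℕ => a p.1 p.2 * w ^ p.2) (g w) := by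
    have := hsum.hasSum.prod_fiberwise fun i => hs i w hw
    rw [(hg w hw).unique this]
    exact hsum.hasSum
  have hswap := (Equiv.prodComm ℕ ℕ).hasSum_iff.2 htot
  have := hswap.prod_fiberwise fun n => (hswap.summable.prod_factor n).hasSum
  simpa [Function.comp_def, tsum_mul_right] using this

lemma pow_mul (hf : HasNonnegPowerSeries f) (k : ℕ) :
    HasNonnegPowerSeries fun w => w ^ k * f w := by
  obtain ⟨a, ha, hs⟩ := hf
  refine ⟨fun n => if k ≤ n then a (n - k) else 0, fun n => by dsimp only; split_ifs <;> simp [ha],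
    ?_⟩
  intro w hw
  rw [← hasSum_nat_add_iff' k, Finset.sum_eq_zero, sub_zero]
  · simpa [pow_add, mul_assoc, mul_comm, mul_left_comm] using (hs w hw).mul_left (w ^ k)
  · intro i hi
    simp [Finset.mem_range.1 hi]

lemma const_mul (hf : HasNonnegPowerSeries f) {c : ℝ} (hc : 0 ≤ c) :
    HasNonnegPowerSeries fun w => c * f w := by
  obtain ⟨a, ha, hs⟩ := hf
  refine ⟨fun n => c * a n, fun n => mul_nonneg hc (ha n), fun w hw => ?_⟩
  simpa [mul_assoc] using (hs w hw).mul_left c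

lemma id : HasNonnegPowerSeries fun w => w := by
  simpa using (const zero_le_one).pow_mul 1

lemma add (hf : HasNonnegPowerSeries f) (hg : HasNonnegPowerSeries g) :
    HasNonnegPowerSeries fun w => f w + g w := by
  obtain ⟨a, ha, hs⟩ := hf
  obtain ⟨b, hb, ht⟩ := hg
  refine ⟨fun n => a n + b n, fun n => add_nonneg (ha n) (hb n), fun w hw => ?_⟩
  simpa [add_mul] using (hs w hw).add (ht w hw)

lemma mul (hf : HasNonnegPowerSeries f) (hg : HasNonnegPowerSeries g) :
    HasNonnegPowerSeries fun w => f w * g w := by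
  obtain ⟨a, ha, hs⟩ := hf
  refine hasSum (f := fun n w => a n * (w ^ n * g w)) (fun n => (hg.pow_mul n).const_mul (ha n)) ?_
  intro w hw
  simpa [mul_assoc] using (hs w hw).mul_right (g w)

lemma pow (hf : HasNonnegPowerSeries f) (n : ℕ) : HasNonnegPowerSeries fun w => f w ^ n := by
  induction n with
  | zero => simpa using const zero_le_one
  | succ n ih => simpa [pow_succ] using ih.mul hf

lemma sum {ι : Type*} (s : Finset ι) {f : ι → ℝ → ℝ} (hf : ∀ i ∈ s, HasNonnegPowerSeries (f i)) :
    HasNonnegPowerSeries fun w => ∑ i ∈ s, f i w := by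
  classical
  induction s using Finset.induction_on with
  | empty => simpa using const le_rfl
  | insert i s hi ih =>
    simp only [Finset.sum_insert hi]
    exact (hf i (by simp)).add (ih fun j hj => hf j (by simp [hj]))

lemma comp (hf : HasNonnegPowerSeries f) (hg : HasNonnegPowerSeries g)
    (hmaps : MapsTo g (Ico 0 1) (Ico 0 1)) : HasNonnegPowerSeries fun w => f (g w) := by
  obtain ⟨a, ha, hs⟩ := hf
  exact hasSum (fun n => (hg.pow n).const_mul (ha n)) fun w hw => hs _ (hmaps hw)

lemma exp (hf : HasNonnegPowerSeries f) : HasNonnegPowerSeries fun w => Real.exp (f w) := by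
  refine hasSum (f := fun n w => (n.factorial : ℝ)⁻¹ * f w ^ n)
    (fun n => (hf.pow n).const_mul (by positivity)) fun w _ => ?_
  simpa [Real.exp_eq_exp_ℝ] using NormedSpace.exp_series_hasSum_exp' (𝕂 := ℝ) (f w)

/-- Abel's theorem for nonnegative coefficients: the limit `1` at `1` is the total mass. -/
lemma exists_pmf (hf : HasNonnegPowerSeries f) (hlim : Tendsto f (𝓝[<] 1) (𝓝 1)) :
    ∃ a : ℕ → ℝ, (∀ n, 0 ≤ a n) ∧ ∑' n, a n = 1 ∧
      ∀ w ∈ Ico (0 : ℝ) 1, f w = ∑' n, a n * w ^ n := by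
  obtain ⟨a, ha, hs⟩ := hf
  have hmem : ∀ᶠ w in 𝓝[<] (1 : ℝ), w ∈ Ico (0 : ℝ) 1 := Ico_mem_nhdsLT zero_lt_one
  have hbound (s : Finset ℕ) : ∑ n ∈ s, a n ≤ 1 := by
    have hc : Tendsto (fun w : ℝ => ∑ n ∈ s, a n * w ^ n) (𝓝[<] 1) (𝓝 (∑ n ∈ s, a n)) := by
      have : Continuous fun w : ℝ => ∑ n ∈ s, a n * w ^ n := by fun_prop
      simpa using (this.tendsto 1).mono_left nhdsWithin_le_nhds
    refine le_of_tendsto_of_tendsto hc hlim ?_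
    filter_upwards [hmem] with w hw
    exact sum_le_hasSum s (fun n _ => mul_nonneg (ha n) (pow_nonneg hw.1 n)) (hs w hw)
  have hsum : Summable a := summable_of_sum_le ha hbound
  refine ⟨a, ha, le_antisymm (hsum.tsum_le_of_sum_le hbound) ?_,
    fun w hw => (hs w hw).tsum_eq.symm⟩
  refine le_of_tendsto hlim ?_
  filter_upwards [hmem] with w hw
  exact hasSum_le (fun n => mul_le_of_le_one_right (ha n) (pow_le_one₀ hw.1 hw.2.le)) (hs w hw)
    hsum.hasSum

/-- A nonnegative power series has an antiderivative with nonnegative coefficients. -/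
lemma exists_antideriv (hf : HasNonnegPowerSeries f) :
    ∃ F : ℝ → ℝ, HasNonnegPowerSeries F ∧ ∀ w ∈ Ico (0 : ℝ) 1, HasDerivAt F (f w) w := by
  obtain ⟨a, ha, hs⟩ := hf
  have hderiv (r : ℝ) (hr : r ∈ Ico (0 : ℝ) 1) (y : ℝ) (hy : y ∈ Ioo (-r) r) :
      HasDerivAt (fun w => ∑' n : ℕ, a n / (n + 1) * w ^ (n + 1)) (∑' n, a n * y ^ n) y := by
    refine hasDerivAt_tsum_of_isPreconnected (g' := fun n y => a n * y ^ n) (hs r hr).summable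
      isOpen_Ioo
      (convex_Ioo (-r) r).isPreconnected
      (fun n z _ => ?_) (fun n z hz => ?_) (y₀ := 0)
      ⟨by linarith [hy.1, hy.2], by linarith [hy.1, hy.2]⟩ ?_ hy
    · convert! ((hasDerivAt_pow (n + 1) z).const_mul (a n / (n + 1))) using 1
      have : (n + 1 : ℝ) ≠ 0 := by positivity
      push_cast [Nat.add_sub_cancel]
      field_simp
    · rw [norm_mul, norm_pow, Real.norm_of_nonneg (ha n)]
      exact mul_le_mul_of_nonneg_left
        (pow_le_pow_left₀ (norm_nonneg _) (abs_lt.2 hz).le n) (ha n)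
    · simp
  refine ⟨fun w => ∑' n : ℕ, a n / (n + 1) * w ^ (n + 1), ?_, fun w hw => ?_⟩
  · have : HasNonnegPowerSeries fun w => ∑' n : ℕ, a n / (n + 1) * w ^ n := by
      refine ⟨fun n => a n / (n + 1), fun n => div_nonneg (ha n) (by positivity), fun w hw => ?_⟩
      refine (Summable.of_nonneg_of_le (fun n => ?_) (fun n => ?_) (hs w hw).summable).hasSum
      · exact mul_nonneg (div_nonneg (ha n) (by positivity)) (pow_nonneg hw.1 n)
      · exact mul_le_mul_of_nonneg_right (div_le_self (ha n) (by simp)) (pow_nonneg hw.1 n)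
    refine (this.pow_mul 1).congr fun w _ => ?_
    rw [← tsum_mul_left]
    exact tsum_congr fun n => by ring
  · rw [← (hs w hw).tsum_eq]
    obtain ⟨r, hr⟩ := exists_between hw.2
    exact hderiv r ⟨hw.1.trans hr.1.le, hr.2⟩ w ⟨by linarith [hw.1, hr.1], hr.1⟩

lemma continuousOn_Icc (hf : HasNonnegPowerSeries f) {r : ℝ} (hr : r < 1) :
    ContinuousOn f (Icc 0 r) := by
  rcases lt_or_ge r 0 with h0 | h0
  · simp [Icc_eq_empty h0.not_ge]
  obtain ⟨a, ha, hs⟩ := hf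
  have : ContinuousOn (fun w => ∑' n, a n * w ^ n) (Icc 0 r) := by
    refine continuousOn_tsum (fun n => by fun_prop) (hs r ⟨h0, hr⟩).summable fun n w hw => ?_
    rw [Real.norm_of_nonneg (mul_nonneg (ha n) (pow_nonneg hw.1 n))]
    exact mul_le_mul_of_nonneg_left (pow_le_pow_left₀ hw.1 hw.2 n) (ha n)
  exact this.congr fun w hw => (hs w ⟨hw.1, hw.2.trans_lt hr⟩).tsum_eq.symm

end HasNonnegPowerSeries

/-- Kaluza's theorem: if the coefficients of `f` are positive and log-convex, then all
coefficients of `1 / f` except the constant one are nonpositive. -/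
theorem exists_inv_eq_sub_of_monotone_ratio {q : ℕ → ℝ} {f : ℝ → ℝ} (hpos : ∀ n, 0 < q n)
    (hmono : Monotone fun n => q (n + 1) / q n)
    (hf : ∀ w ∈ Ico (0 : ℝ) 1, HasSum (fun n => q n * w ^ n) (f w)) :
    ∃ g : ℝ → ℝ, HasNonnegPowerSeries g ∧
      ∀ w ∈ Ico (0 : ℝ) 1, (f w)⁻¹ = (q 0)⁻¹ - w * g w := by
  obtain ⟨k, hk⟩ : ∃ k : ℕ → ℝ, ∀ n,
      ∑ p ∈ antidiagonal n, k p.1 * q p.2 = q (n + 1) / q 0 := by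
    let F : PowerSeries ℝ := PowerSeries.mk q
    let G : PowerSeries ℝ := PowerSeries.mk fun n => q (n + 1) / q 0
    refine ⟨fun n => PowerSeries.coeff n (G * F⁻¹), fun n => ?_⟩
    have hF : G * F⁻¹ * F = G := by
      rw [mul_assoc, PowerSeries.inv_mul_cancel, mul_one]
      simp [F, (hpos 0).ne']
    have := congrArg (PowerSeries.coeff n) hF
    rw [PowerSeries.coeff_mul] at this
    simpa [F, G] using this
  have hk0 : ∀ n, 0 ≤ k n := by
    intro n
    induction n using Nat.strong_induction_on with
    | _ n ih =>
      refine nonneg_of_mul_nonneg_left (b := q 0) ?_ (hpos 0)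
      rcases n with - | n
      · have := hk 0
        simp only [Finset.Nat.antidiagonal_zero, Finset.sum_singleton] at this
        exact this ▸ (div_pos (hpos _) (hpos _)).le
      · have hsucc := hk (n + 1)
        rw [Finset.Nat.sum_antidiagonal_succ'] at hsucc
        have hle : ∑ p ∈ antidiagonal n, k p.1 * q (p.2 + 1) ≤
            q (n + 2) / q (n + 1) * ∑ p ∈ antidiagonal n, k p.1 * q p.2 := by
          rw [Finset.mul_sum]
          refine Finset.sum_le_sum fun p hp => ?_
          have hpn := mem_antidiagonal.1 hp
          have hr := (div_le_iff₀ (hpos p.2)).1 (hmono (show p.2 ≤ n + 1 by omega))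
          have := mul_le_mul_of_nonneg_left hr (ih p.1 (by omega))
          linarith
        rw [hk n] at hle
        have heq : q (n + 2) / q (n + 1) * (q (n + 1) / q 0) = q (n + 2) / q 0 := by
          have := (hpos (n + 1)).ne'
          field_simp
        rw [heq] at hle
        have h2 : q (n + 1 + 1) = q (n + 2) := rfl
        simp only [h2] at hsucc
        linarith
  have hbound : ∀ n, k n ≤ q (n + 1) / q 0 / q 0 := by
    intro n
    rw [le_div_iff₀ (hpos 0), ← hk n]
    exact Finset.single_le_sum (f := fun p : ℕ × ℕ => k p.1 * q p.2)
      (fun p _ => mul_nonneg (hk0 _) (hpos _).le) (a := (n, 0)) (by simp)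
  have hshift : ∀ w ∈ Ico (0 : ℝ) 1, Summable fun n => q (n + 1) * w ^ n := by
    intro w hw
    obtain ⟨r, hwr, hr⟩ := exists_between hw.2
    have hr0 : 0 < r := hw.1.trans_lt hwr
    have := (((summable_nat_add_iff 1).2 (hf r ⟨hr0.le, hr⟩).summable).mul_left r⁻¹)
    refine Summable.of_nonneg_of_le
      (fun n => mul_nonneg (hpos _).le (pow_nonneg hw.1 n)) (fun n => ?_) this
    calc q (n + 1) * w ^ n ≤ q (n + 1) * r ^ n :=
          mul_le_mul_of_nonneg_left (pow_le_pow_left₀ hw.1 hwr.le n) (hpos _).le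
      _ = r⁻¹ * (q (n + 1) * r ^ (n + 1)) := by field_simp; ring
  have hksum : ∀ w ∈ Ico (0 : ℝ) 1, Summable fun n => k n * w ^ n := by
    intro w hw
    refine Summable.of_nonneg_of_le (fun n => mul_nonneg (hk0 n) (pow_nonneg hw.1 n))
      (fun n => ?_) ((hshift w hw).mul_left (q 0 * q 0)⁻¹)
    calc k n * w ^ n ≤ q (n + 1) / q 0 / q 0 * w ^ n :=
          mul_le_mul_of_nonneg_right (hbound n) (pow_nonneg hw.1 n)
      _ = (q 0 * q 0)⁻¹ * (q (n + 1) * w ^ n) := by field_simp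
  refine ⟨fun w => ∑' n, k n * w ^ n, ⟨k, hk0, fun w hw => (hksum w hw).hasSum⟩, fun w hw => ?_⟩
  have hprod := tsum_mul_tsum_eq_tsum_sum_antidiagonal_of_summable_norm (hksum w hw).norm
    (hf w hw).summable.norm
  have hterm : ∀ n, ∑ p ∈ antidiagonal n, k p.1 * w ^ p.1 * (q p.2 * w ^ p.2) =
      (q 0)⁻¹ * (q (n + 1) * w ^ n) := by
    intro n
    calc _ = ∑ p ∈ antidiagonal n, k p.1 * q p.2 * w ^ n := by
          refine Finset.sum_congr rfl fun p hp => ?_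
          rw [← mem_antidiagonal.1 hp, pow_add]
          ring
      _ = _ := by
          rw [← Finset.sum_mul, hk n]
          ring
  simp only [hterm, tsum_mul_left, (hf w hw).tsum_eq] at hprod
  have hzero := (hf w hw).summable.tsum_eq_zero_add
  simp only [(hf w hw).tsum_eq, pow_succ', mul_left_comm _ w, tsum_mul_left, pow_zero,
    mul_one] at hzero
  refine inv_eq_of_mul_eq_one_right ?_
  have h0 := (hpos 0).ne'
  have : f w * (w * ∑' n, k n * w ^ n) = (q 0)⁻¹ * (f w - q 0) := by
    linear_combination w * hprod - (q 0)⁻¹ * hzero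
  rw [mul_sub, this]
  field_simp
  ring

/-- The Sibuya pgf divided by `v`, with its positive, log-convex coefficients. -/
lemma exists_sibuya_div_series {α : ℝ} (hα : α ∈ Ioo (0 : ℝ) 1) :
    ∃ (q : ℕ → ℝ) (f : ℝ → ℝ), (∀ n, 0 < q n) ∧ (Monotone fun n => q (n + 1) / q n) ∧ q 0 = α ∧
      ∀ v ∈ Ico (0 : ℝ) 1, HasSum (fun n => q n * v ^ n) (f v) ∧ v * f v = 1 - (1 - v) ^ α := by
  have hchoose (n : ℕ) : Ring.choose α (n + 1) * (n + 1) = Ring.choose α n * (α - n) := by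
    have := Ring.descPochhammer_eq_factorial_smul_choose α (n + 1)
    rw [descPochhammer_succ_right, Polynomial.smeval_mul,
      Ring.descPochhammer_eq_factorial_smul_choose] at this
    simp [Polynomial.smeval_sub, Polynomial.smeval_natCast, Nat.factorial_succ] at this
    have hn : (n.factorial : ℝ) ≠ 0 := by positivity
    apply mul_left_cancel₀ hn
    linear_combination -this
  let q : ℕ → ℝ := fun n => (-1) ^ n * Ring.choose α (n + 1)
  have hq (n : ℕ) : q (n + 1) = q n * ((n + 1 - α) / (n + 2)) := by
    have := hchoose (n + 1)
    push_cast at this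
    simp only [q, pow_succ]
    have hn : (n + 2 : ℝ) ≠ 0 := by positivity
    rw [← mul_div_assoc, eq_div_iff hn]
    linear_combination (-(-1) ^ n) * this
  have hq0 : q 0 = α := by simp [q]
  have hpos (n : ℕ) : 0 < q n := by
    induction n with
    | zero => exact hq0 ▸ hα.1
    | succ n ih =>
      rw [hq]
      have : 0 < (n + 1 - α : ℝ) := by linarith [hα.2, (Nat.cast_nonneg n : (0 : ℝ) ≤ n)]
      positivity
  have hratio (n : ℕ) : q (n + 1) / q n = 1 - (1 + α) / (n + 2) := by
    rw [hq, mul_div_cancel_left₀ _ (hpos n).ne']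
    field_simp
    ring
  have hmono : Monotone fun n => q (n + 1) / q n := by
    refine monotone_nat_of_le_succ fun n => ?_
    have := hα.1
    rw [hratio, hratio]
    push_cast
    gcongr
    linarith
  have hbin (v : ℝ) (hv : v ∈ Ico (0 : ℝ) 1) :
      HasSum (fun n => q n * v ^ (n + 1)) (1 - (1 - v) ^ α) := by
    have hmem : -v ∈ Metric.eball (0 : ℝ) 1 := by
      simpa [← ofReal_norm, abs_of_nonneg hv.1] using hv.2
    have := (Real.one_add_rpow_hasFPowerSeriesOnBall_zero (a := α)).hasSum hmem
    simp only [binomialSeries_apply, List.ofFn_const, List.prod_replicate, smul_eq_mul,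
      zero_add] at this
    rw [← hasSum_nat_add_iff' 1] at this
    convert! this.neg using 1
    · ext n
      simp only [q, neg_pow v]
      ring
    · simp [sub_eq_add_neg]
  have hsum (v : ℝ) (hv : v ∈ Ico (0 : ℝ) 1) : Summable fun n => q n * v ^ n := by
    rcases hv.1.eq_or_lt with rfl | h0
    · refine summable_of_ne_finset_zero (s := {0}) fun n hn => ?_
      simp [Finset.notMem_singleton.1 hn]
    · refine ((hbin v hv).summable.mul_left v⁻¹).congr fun n => ?_
      field_simp
      ring
  refine ⟨q, fun v => ∑' n, q n * v ^ n, hpos, hmono, hq0, fun v hv => ⟨(hsum v hv).hasSum, ?_⟩⟩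
  rw [← (hbin v hv).tsum_eq, ← tsum_mul_left]
  exact tsum_congr fun n => by ring

/-- The pgf `(1 - (1 - v) ^ α) / v` is self-decomposable on `[0, 1)`. -/
lemma exists_sibuya_div_selfDecomposable {α : ℝ} (hα : α ∈ Ioo (0 : ℝ) 1) :
    ∃ f : ℝ → ℝ, HasNonnegPowerSeries f ∧ f 0 = α ∧
      (∀ v ∈ Ico (0 : ℝ) 1, v * f v = 1 - (1 - v) ^ α) ∧
      ∀ c ∈ Ioo (0 : ℝ) 1, HasNonnegPowerSeries fun v => f v / f (1 - c * (1 - v)) := by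
  obtain ⟨q, f, hpos, hmono, hq0, hf⟩ := exists_sibuya_div_series hα
  obtain ⟨g, ⟨k, hk, hg⟩, hinv⟩ :=
    exists_inv_eq_sub_of_monotone_ratio hpos hmono fun w hw => (hf w hw).1
  have hfps : HasNonnegPowerSeries f := ⟨q, fun n => (hpos n).le, fun w hw => (hf w hw).1⟩
  have hf0 : f 0 = α := by
    rw [← hq0, ← (hf 0 (by simp)).1.tsum_eq, tsum_eq_single 0 fun n hn => by simp [hn]]
    simp
  have hfpos (v : ℝ) (hv : v ∈ Ico (0 : ℝ) 1) : 0 < f v :=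
    (hpos 0).trans_le <| by
      simpa using (hf v hv).1.summable.le_tsum 0
        (fun n _ => mul_nonneg (hpos n).le (pow_nonneg hv.1 n)) |>.trans_eq (hf v hv).1.tsum_eq
  refine ⟨f, hfps, hf0, fun v hv => (hf v hv).2, fun c hc => ?_⟩
  have hlog (v : ℝ) (hv : v ∈ Ioo (0 : ℝ) 1) :
      HasDerivAt (fun x => Real.log (f x)) ((1 - α - α * g v) / (1 - v)) v := by
    have hv' : v ∈ Ico (0 : ℝ) 1 := ⟨hv.1.le, hv.2⟩
    have h1v : 0 < 1 - v := sub_pos.2 hv.2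
    have hu : 0 < 1 - (1 - v) ^ α := by
      rw [← (hf v hv').2]
      exact mul_pos hv.1 (hfpos v hv')
    have hd : HasDerivAt (fun x : ℝ => Real.log (1 - (1 - x) ^ α) - Real.log x)
        (α * (1 - v) ^ (α - 1) / (1 - (1 - v) ^ α) - v⁻¹) v := by
      have h1 : HasDerivAt (fun x : ℝ => 1 - (1 - x) ^ α) (α * (1 - v) ^ (α - 1)) v := by
        convert! (((hasDerivAt_id v).const_sub 1).rpow_const (p := α)
          (Or.inl h1v.ne')).const_sub 1 using 1
        simp
      exact (h1.log hu.ne').sub (Real.hasDerivAt_log hv.1.ne')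
    have hval : α * (1 - v) ^ (α - 1) / (1 - (1 - v) ^ α) - v⁻¹ =
        (1 - α - α * g v) / (1 - v) := by
      have hi := hinv v hv'
      have hfv : f v = (1 - (1 - v) ^ α) / v := by
        rw [← (hf v hv').2, mul_div_cancel_left₀ _ hv.1.ne']
      rw [hfv, hq0, inv_div] at hi
      rw [Real.rpow_sub_one h1v.ne']
      generalize (1 - v) ^ α = u at hu hi ⊢
      have hv0 := hv.1.ne'
      have hα0 := hα.1.ne'
      have hg' : g v = (α⁻¹ - v / (1 - u)) / v := by
        rw [hi]
        field_simp
        ring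
      rw [hg']
      have := hu.ne'
      have := h1v.ne'
      field_simp
      ring
    rw [← hval]
    refine hd.congr_of_eventuallyEq ?_
    filter_upwards [isOpen_Ioo.mem_nhds hv] with x hx
    have hx' : x ∈ Ico (0 : ℝ) 1 := ⟨hx.1.le, hx.2⟩
    rw [← (hf x hx').2, Real.log_mul hx.1.ne' (hfpos x hx').ne']
    ring
  have hy (v : ℝ) (hv : v ∈ Ico (0 : ℝ) 1) : 1 - c * (1 - v) ∈ Ioo (0 : ℝ) 1 := by
    have h1 : 0 < 1 - v := sub_pos.2 hv.2
    constructor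
    · nlinarith [hc.1, hc.2, hv.1]
    · nlinarith [hc.1]
  have hyps : HasNonnegPowerSeries fun v => 1 - c * (1 - v) :=
    ((HasNonnegPowerSeries.const (sub_nonneg.2 hc.2.le)).add
      (HasNonnegPowerSeries.id.const_mul hc.1.le)).congr fun v _ => by ring
  have hM : HasNonnegPowerSeries fun v => α * ((g (1 - c * (1 - v)) - g v) / (1 - v)) := by
    refine HasNonnegPowerSeries.const_mul ?_ hα.1.le
    refine HasNonnegPowerSeries.hasSum
      (f := fun n v => k n * (((1 - c * (1 - v)) ^ n - v ^ n) / (1 - v)))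
      (fun n => HasNonnegPowerSeries.const_mul ?_ (hk n)) fun v hv => ?_
    · refine ((HasNonnegPowerSeries.sum (Finset.range n) fun i _ =>
        (hyps.pow i).mul (HasNonnegPowerSeries.id.pow (n - 1 - i))).const_mul
          (sub_nonneg.2 hc.2.le)).congr fun v hv => ?_
      rw [← geom_sum₂_mul]
      have : 1 - v ≠ 0 := (sub_pos.2 hv.2).ne'
      field_simp
      ring
    · have := ((hg _ ⟨(hy v hv).1.le, (hy v hv).2⟩).sub (hg v hv)).div_const (1 - v)
      simpa only [← mul_sub, mul_div_assoc] using this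
  obtain ⟨L, hL, hLd⟩ := hM.exists_antideriv
  let G : ℝ → ℝ := fun v => Real.log (f v) - Real.log (f (1 - c * (1 - v))) - L v
  have hG (v : ℝ) (hv : v ∈ Ico (0 : ℝ) 1) : G v = G 0 := by
    rcases hv.1.eq_or_lt with rfl | h0
    · rfl
    have hcf : ContinuousOn (fun x => Real.log (f x)) (Icc 0 v) :=
      (hfps.continuousOn_Icc hv.2).log fun x hx => (hfpos x ⟨hx.1, hx.2.trans_lt hv.2⟩).ne'
    have hcy : ContinuousOn (fun x => Real.log (f (1 - c * (1 - x)))) (Icc 0 v) := by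
      intro x hx
      have hx' := hy x ⟨hx.1, hx.2.trans_lt hv.2⟩
      exact ((hlog _ hx').continuousAt.comp (f := fun x => 1 - c * (1 - x))
        (by fun_prop)).continuousWithinAt
    have hcL : ContinuousOn L (Icc 0 v) := fun x hx =>
      (hLd x ⟨hx.1, hx.2.trans_lt hv.2⟩).continuousAt.continuousWithinAt
    have hGd (x : ℝ) (hx : x ∈ Ioo 0 v) : HasDerivAt G 0 x := by
      have hx' : x ∈ Ioo (0 : ℝ) 1 := ⟨hx.1, hx.2.trans hv.2⟩
      have hxy := hy x ⟨hx'.1.le, hx'.2⟩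
      have hdy : HasDerivAt (fun x : ℝ => 1 - c * (1 - x)) c x := by
        convert! (((hasDerivAt_id x).const_sub 1).const_mul c).const_sub 1 using 1
        simp
      have := ((hlog x hx').sub ((hlog _ hxy).comp x hdy)).sub (hLd x ⟨hx'.1.le, hx'.2⟩)
      convert! this using 1
      have h1 : 1 - x ≠ 0 := (sub_pos.2 hx'.2).ne'
      have h2 := hc.1.ne'
      have h3 : 1 - (1 - c * (1 - x)) = c * (1 - x) := by ring
      rw [h3]
      field_simp
      ring
    obtain ⟨x, -, hx⟩ := exists_hasDerivAt_eq_slope G (fun _ => 0) h0 ((hcf.sub hcy).sub hcL) hGd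
    rw [eq_comm, div_eq_zero_iff, sub_zero] at hx
    exact sub_eq_zero.1 (hx.resolve_right h0.ne')
  refine (hL.exp.const_mul (Real.exp_pos (G 0)).le).congr fun v hv => ?_
  rw [← hG v hv, ← Real.exp_add]
  have hfy := hfpos _ ⟨(hy v hv).1.le, (hy v hv).2⟩
  simp only [G, sub_add_cancel]
  rw [Real.exp_sub, Real.exp_log (hfpos v hv), Real.exp_log hfy]

/-- The ratio of Sibuya pgfs `S(αγ,w)/S(γ,w)` is a self-decomposable pgf. -/
theorem stmt_6 (α γ : ℝ) (hα : α ∈ Set.Ioo (0:ℝ) 1) (hγ : γ ∈ Set.Ioo (0:ℝ) 1)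
    (Q : ℝ → ℝ) (hQ0 : Q 0 = α)
    (hQ : ∀ w ∈ Set.Ioc (0:ℝ) 1,
      Q w = (1 - (1 - w) ^ (α * γ)) / (1 - (1 - w) ^ γ)) :
    (∃ q : ℕ → ℝ, (∀ n, 0 ≤ q n) ∧ (∑' n, q n = 1) ∧
      ∀ w ∈ Set.Icc (0:ℝ) 1, Q w = ∑' n : ℕ, q n * w ^ n) ∧
    (∀ a ∈ Set.Ioo (0:ℝ) 1, ∃ h : ℕ → ℝ, (∀ m, 0 ≤ h m) ∧ (∑' m, h m = 1) ∧
      ∀ w ∈ Set.Icc (0:ℝ) 1, Q w = Q (1 - a * (1 - w)) * ∑' m : ℕ, h m * w ^ m) := by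
  obtain ⟨f, hf, hf0, hfα, hfc⟩ := exists_sibuya_div_selfDecomposable hα
  obtain ⟨s, hs, -, hsγ, -⟩ := exists_sibuya_div_selfDecomposable hγ
  have hS : HasNonnegPowerSeries fun w => 1 - (1 - w) ^ γ :=
    (hs.pow_mul 1).congr fun w hw => by rw [pow_one, hsγ w hw]
  have hSmaps : MapsTo (fun w : ℝ => 1 - (1 - w) ^ γ) (Ico 0 1) (Ico 0 1) := fun w hw =>
    ⟨sub_nonneg.2 (Real.rpow_le_one (sub_nonneg.2 hw.2.le) (sub_le_self _ hw.1) hγ.1.le),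
      sub_lt_self _ (Real.rpow_pos_of_pos (sub_pos.2 hw.2) _)⟩
  have hSpos (w : ℝ) (hw : w ∈ Ioc (0 : ℝ) 1) : 0 < 1 - (1 - w) ^ γ :=
    sub_pos.2 (Real.rpow_lt_one (sub_nonneg.2 hw.2) (sub_lt_self _ hw.1) hγ.1)
  have hQpos (w : ℝ) (hw : w ∈ Ioc (0 : ℝ) 1) : 0 < Q w := by
    rw [hQ w hw]
    exact div_pos (sub_pos.2 (Real.rpow_lt_one (sub_nonneg.2 hw.2) (sub_lt_self _ hw.1)
      (mul_pos hα.1 hγ.1))) (hSpos w hw)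
  have hQf (w : ℝ) (hw : w ∈ Ico (0 : ℝ) 1) : Q w = f (1 - (1 - w) ^ γ) := by
    rcases hw.1.eq_or_lt with rfl | h0
    · simp [hQ0, hf0]
    · have h := hSpos w ⟨h0, hw.2.le⟩
      rw [hQ w ⟨h0, hw.2.le⟩, div_eq_iff h.ne', mul_comm (f _), hfα _ (hSmaps hw),
        sub_sub_cancel, ← Real.rpow_mul (sub_nonneg.2 hw.2.le), mul_comm γ]
  have hQ1 : Q 1 = 1 := by
    rw [hQ 1 (by simp)]
    simp [Real.zero_rpow hγ.1.ne', Real.zero_rpow (mul_pos hα.1 hγ.1).ne']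
  have hQlim : Tendsto Q (𝓝[<] 1) (𝓝 1) := by
    have hpow (p : ℝ) (hp : 0 < p) : ContinuousAt (fun w : ℝ => 1 - (1 - w) ^ p) 1 := by
      refine continuousAt_const.sub (ContinuousAt.rpow_const (by fun_prop) (Or.inr hp.le))
    have hc := (hpow (α * γ) (mul_pos hα.1 hγ.1)).div (hpow γ hγ.1)
      (by simp [Real.zero_rpow hγ.1.ne'])
    have := hc.tendsto.mono_left (nhdsWithin_le_nhds (s := Iio 1))
    rw [Pi.div_apply, ← hQ 1 (by simp), hQ1] at this
    refine this.congr' ?_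
    filter_upwards [Ioo_mem_nhdsLT zero_lt_one] with w hw
    exact (hQ w ⟨hw.1, hw.2.le⟩).symm
  refine ⟨?_, fun a ha => ?_⟩
  · obtain ⟨q, hq, hq1, hqs⟩ := ((hf.comp hS hSmaps).congr hQf).exists_pmf hQlim
    refine ⟨q, hq, hq1, fun w hw => ?_⟩
    rcases hw.2.eq_or_lt with rfl | h1
    · simp [hQ1, hq1]
    · exact hqs w ⟨hw.1, h1⟩
  · have hy (w : ℝ) (hw : w ∈ Ico (0 : ℝ) 1) : 1 - a * (1 - w) ∈ Ioo (0 : ℝ) 1 := by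
      have h1 : 0 < 1 - w := sub_pos.2 hw.2
      constructor
      · nlinarith [ha.1, ha.2, hw.1]
      · nlinarith [ha.1]
    have hc : a ^ γ ∈ Ioo (0 : ℝ) 1 :=
      ⟨Real.rpow_pos_of_pos ha.1 _, Real.rpow_lt_one ha.1.le ha.2 hγ.1⟩
    have hH : HasNonnegPowerSeries fun w => Q w / Q (1 - a * (1 - w)) := by
      refine ((hfc _ hc).comp hS hSmaps).congr fun w hw => ?_
      rw [hQf w hw, hQf _ ⟨(hy w hw).1.le, (hy w hw).2⟩, sub_sub_cancel, sub_sub_cancel,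
        Real.mul_rpow ha.1.le (sub_nonneg.2 hw.2.le)]
    have hylim : Tendsto (fun w : ℝ => 1 - a * (1 - w)) (𝓝[<] 1) (𝓝[<] 1) := by
      refine tendsto_nhdsWithin_iff.2 ⟨?_, ?_⟩
      · have : ContinuousAt (fun w : ℝ => 1 - a * (1 - w)) 1 := by fun_prop
        simpa using this.tendsto.mono_left (nhdsWithin_le_nhds (s := Iio 1))
      · filter_upwards [Ico_mem_nhdsLT zero_lt_one] with w hw
        exact (hy w hw).2
    have hHlim := hQlim.div (hQlim.comp hylim) one_ne_zero
    rw [div_one] at hHlim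
    obtain ⟨h, hh, hh1, hhs⟩ := hH.exists_pmf hHlim
    refine ⟨h, hh, hh1, fun w hw => ?_⟩
    rcases hw.2.eq_or_lt with rfl | h1
    · simp [hQ1, hh1]
    · have hyw := hy w ⟨hw.1, h1⟩
      rw [← hhs w ⟨hw.1, h1⟩, mul_div_cancel₀ _ (hQpos _ ⟨hyw.1, hyw.2.le⟩).ne']
end

section
/- Let b ∈ (0,1] and γ ∈ (0,1). Define p : ℕ → ℝ by p_0 = 0, p_1 = bγ/(1-(1-b)^γ), and the recurrence p_{n+1} = b(n-γ) p_n/(n+1) for n ≥ 1. Then p_n ≥ 0 for all n, ∑_{n=1}^∞ p_n = 1, and for all w ∈ [0,1] the probability generating function satisfies ∑_{n=1}^∞ p_n w^n = (1-(1-bw)^γ)/(1-(1-b)^γ). -/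
/-- The mass `(-1) ^ n * choose γ (n + 1)` that the Sibuya distribution puts on `n + 1`. -/
noncomputable def sibuyaMass (γ : ℝ) (n : ℕ) : ℝ := (-1) ^ n * Ring.choose γ (n + 1)

lemma sibuyaMass_zero (γ : ℝ) : sibuyaMass γ 0 = γ := by
  simp [sibuyaMass]

lemma sibuyaMass_succ (γ : ℝ) (n : ℕ) :
    sibuyaMass γ (n + 1) = ((n : ℝ) + 1 - γ) * sibuyaMass γ n / ((n : ℝ) + 2) := by
  have h := Ring.choose_smul_choose γ (Nat.le_succ (n + 1))
  simp only [Nat.succ_eq_add_one, Nat.choose_succ_self_right, nsmul_eq_mul,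
    add_tsub_cancel_left, Ring.choose_one_right] at h
  push_cast at h
  rw [eq_div_iff (by positivity)]
  simp only [sibuyaMass, pow_succ]
  linear_combination (-(-1) ^ n) * h

lemma sibuyaMass_nonneg {γ : ℝ} (hγ : γ ∈ Set.Ioo (0 : ℝ) 1) (n : ℕ) : 0 ≤ sibuyaMass γ n := by
  induction n with
  | zero => rw [sibuyaMass_zero]; exact hγ.1.le
  | succ n ih =>
    rw [sibuyaMass_succ]
    have : (0 : ℝ) ≤ (n : ℝ) + 1 - γ := by linarith [hγ.2, (Nat.cast_nonneg n : (0 : ℝ) ≤ n)]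
    positivity

lemma hasSum_sibuyaMass_of_abs_lt_one (γ : ℝ) {x : ℝ} (hx : |x| < 1) :
    HasSum (fun n => sibuyaMass γ n * x ^ (n + 1)) (1 - (1 - x) ^ γ) := by
  have h := (Real.one_add_rpow_hasFPowerSeriesOnBall_zero (a := γ)).hasSum
    (y := -x) (by simpa [enorm_eq_nnnorm, ← NNReal.coe_lt_coe] using hx)
  simp only [binomialSeries_apply, List.ofFn_const, List.prod_replicate, smul_eq_mul,
    zero_add] at h
  rw [← hasSum_nat_add_iff' 1] at h
  convert! h.neg using 1
  · ext n
    rw [sibuyaMass, neg_pow x (n + 1), pow_succ (-1 : ℝ)]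
    ring
  · simp [sub_eq_add_neg]

lemma summable_sibuyaMass {γ : ℝ} (hγ : γ ∈ Set.Ioo (0 : ℝ) 1) : Summable (sibuyaMass γ) := by
  refine summable_of_sum_range_le (c := 1) (sibuyaMass_nonneg hγ) fun N => ?_
  have hlim : Filter.Tendsto (fun x : ℝ => ∑ n ∈ Finset.range N, sibuyaMass γ n * x ^ (n + 1))
      (nhdsWithin 1 (Set.Iio 1)) (nhds (∑ n ∈ Finset.range N, sibuyaMass γ n)) := by
    have hc : Continuous fun x : ℝ => ∑ n ∈ Finset.range N, sibuyaMass γ n * x ^ (n + 1) := by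
      fun_prop
    simpa using (hc.tendsto 1).mono_left nhdsWithin_le_nhds
  refine le_of_tendsto hlim ?_
  filter_upwards [Ioo_mem_nhdsLT (zero_lt_one' ℝ)] with x hx
  have hs := hasSum_sibuyaMass_of_abs_lt_one γ (abs_lt.2 ⟨by linarith [hx.1], hx.2⟩)
  refine (sum_le_hasSum _ (fun n _ => mul_nonneg (sibuyaMass_nonneg hγ n)
    (pow_nonneg hx.1.le _)) hs).trans ?_
  linarith [Real.rpow_nonneg (sub_nonneg.2 hx.2.le) γ]

lemma hasSum_sibuyaMass {γ : ℝ} (hγ : γ ∈ Set.Ioo (0 : ℝ) 1) : HasSum (sibuyaMass γ) 1 := by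
  have hs := (summable_sibuyaMass hγ).hasSum
  have habel := Real.tendsto_tsum_powerSeries_nhdsWithin_lt hs.tendsto_sum_nat
  have hlim : Filter.Tendsto (fun x : ℝ => (1 - (1 - x) ^ γ) / x)
      (nhdsWithin 1 (Set.Iio 1)) (nhds 1) := by
    have hc : ContinuousAt (fun x : ℝ => (1 - (1 - x) ^ γ) / x) 1 := by
      refine ContinuousAt.div ?_ continuousAt_id one_ne_zero
      exact continuousAt_const.sub
        ((continuousAt_const.sub continuousAt_id).rpow_const (Or.inr hγ.1.le))
    have h := hc.tendsto
    simp only [sub_self, Real.zero_rpow hγ.1.ne', sub_zero, div_one] at h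
    exact h.mono_left nhdsWithin_le_nhds
  have heq : (fun x : ℝ => (1 - (1 - x) ^ γ) / x) =ᶠ[nhdsWithin 1 (Set.Iio 1)]
      fun x => ∑' n, sibuyaMass γ n * x ^ n := by
    filter_upwards [Ioo_mem_nhdsLT (zero_lt_one' ℝ)] with x hx
    rw [← (hasSum_sibuyaMass_of_abs_lt_one γ
      (abs_lt.2 ⟨by linarith [hx.1], hx.2⟩)).tsum_eq, div_eq_iff hx.1.ne', ← tsum_mul_right]
    simp only [pow_succ, mul_assoc]
  rwa [tendsto_nhds_unique habel (hlim.congr' heq)] at hs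

lemma hasSum_sibuyaMass_mul_pow {γ : ℝ} (hγ : γ ∈ Set.Ioo (0 : ℝ) 1) {x : ℝ}
    (hx : x ∈ Set.Icc (0 : ℝ) 1) :
    HasSum (fun n => sibuyaMass γ n * x ^ (n + 1)) (1 - (1 - x) ^ γ) := by
  rcases hx.2.lt_or_eq with h | rfl
  · exact hasSum_sibuyaMass_of_abs_lt_one γ (abs_lt.2 ⟨by linarith [hx.1], h⟩)
  · simpa [Real.zero_rpow hγ.1.ne'] using hasSum_sibuyaMass hγ

/-- The extended Sibuya sequence is a pmf on `{1,2,…}` with pgf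
`(1-(1-bw)^γ)/(1-(1-b)^γ)`. -/
theorem stmt_11 (b γ : ℝ) (hb : b ∈ Set.Ioc (0:ℝ) 1) (hγ : γ ∈ Set.Ioo (0:ℝ) 1)
    (p : ℕ → ℝ) (hp0 : p 0 = 0)
    (hp1 : p 1 = b * γ / (1 - (1 - b) ^ γ))
    (hrec : ∀ n : ℕ, 1 ≤ n → p (n + 1) = b * ((n : ℝ) - γ) * p n / ((n : ℝ) + 1)) :
    (∀ n, 0 ≤ p n) ∧ (∑' n : ℕ, p (n + 1) = 1) ∧
    (∀ w ∈ Set.Icc (0:ℝ) 1,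
      ∑' n : ℕ, p (n + 1) * w ^ (n + 1) = (1 - (1 - b * w) ^ γ) / (1 - (1 - b) ^ γ)) := by
  have hS : 0 < 1 - (1 - b) ^ γ :=
    sub_pos.2 (Real.rpow_lt_one (by linarith [hb.2]) (by linarith [hb.1]) hγ.1)
  have hp : ∀ n, p (n + 1) = sibuyaMass γ n * b ^ (n + 1) / (1 - (1 - b) ^ γ) := by
    intro n
    induction n with
    | zero => rw [hp1, sibuyaMass_zero]; ring
    | succ n ih =>
      rw [hrec (n + 1) n.succ_pos, ih, sibuyaMass_succ]
      push_cast
      rw [show (n : ℝ) + 1 + 1 = n + 2 by ring]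
      ring
  have hpgf : ∀ w ∈ Set.Icc (0:ℝ) 1,
      ∑' n : ℕ, p (n + 1) * w ^ (n + 1) = (1 - (1 - b * w) ^ γ) / (1 - (1 - b) ^ γ) := by
    intro w hw
    have hbw : b * w ∈ Set.Icc (0 : ℝ) 1 :=
      ⟨mul_nonneg hb.1.le hw.1, mul_le_one₀ hb.2 hw.1 hw.2⟩
    rw [← ((hasSum_sibuyaMass_mul_pow hγ hbw).div_const _).tsum_eq]
    refine tsum_congr fun n => ?_
    rw [hp, mul_pow]
    ring
  refine ⟨fun n => ?_, ?_, hpgf⟩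
  · cases n with
    | zero => exact hp0.ge
    | succ n =>
      rw [hp]
      exact div_nonneg (mul_nonneg (sibuyaMass_nonneg hγ n) (pow_nonneg hb.1.le _)) hS.le
  · simpa [div_self hS.ne'] using hpgf 1 (by simp)
end

section
/- Let b ∈ (0,1) and w ∈ [0,1]. Then lim_{γ → 0⁺} (1-(1-bw)^γ)/(1-(1-b)^γ) = log(1-bw)/log(1-b); that is, as γ → 0 the extended Sibuya probability generating function converges pointwise to the probability generating function of the logarithmic distribution. -/
open Filter Topology in
/-- The right difference quotient at `0` of `γ ↦ 1 - a ^ γ`. -/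
theorem tendsto_one_sub_rpow_div {a : ℝ} (ha : 0 < a) :
    Tendsto (fun γ : ℝ => (1 - a ^ γ) / γ) (𝓝[>] 0) (𝓝 (-Real.log a)) := by
  have hderiv : HasDerivAt (fun γ : ℝ => a ^ γ) (Real.log a) 0 := by
    simpa using (hasDerivAt_id (0 : ℝ)).const_rpow ha
  have h := hderiv.tendsto_slope_zero_right.neg
  refine h.congr fun γ => ?_
  simp only [zero_add, Real.rpow_zero, smul_eq_mul]
  ring

/-- As `γ → 0⁺`, the extended Sibuya pgf converges pointwise to the pgf of the
logarithmic distribution. -/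
theorem stmt_12 (b w : ℝ) (hb : b ∈ Set.Ioo (0:ℝ) 1) (hw : w ∈ Set.Icc (0:ℝ) 1) :
    Filter.Tendsto (fun γ : ℝ => (1 - (1 - b * w) ^ γ) / (1 - (1 - b) ^ γ))
      (nhdsWithin 0 (Set.Ioi 0))
      (nhds (Real.log (1 - b * w) / Real.log (1 - b))) := by
  obtain ⟨hb0, hb1⟩ := hb
  have hbw : 0 < 1 - b * w := by nlinarith [hw.2]
  have hlog : -Real.log (1 - b) ≠ 0 :=
    neg_ne_zero.mpr (Real.log_neg (by linarith) (by linarith)).ne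
  have h := (tendsto_one_sub_rpow_div hbw).div
    (tendsto_one_sub_rpow_div (sub_pos.mpr hb1)) hlog
  rw [neg_div_neg_eq] at h
  refine h.congr' ?_
  filter_upwards [self_mem_nhdsWithin] with γ hγ
  exact div_div_div_cancel_right₀ (ne_of_gt hγ) _ _
end

section
/- Let b ∈ (0,1] and γ ∈ (0,1), let p be the extended Sibuya probability mass function (p_1 = bγ/(1-(1-b)^γ), p_{n+1} = b(n-γ)p_n/(n+1) for n ≥ 1), and define the shifted pmf r_n = p_{n+1} for n ∈ ℕ. Then the shifted extended Sibuya distribution is self-decomposable: for every a ∈ (0,1) there exists a probability mass function h with ∑_{n=0}^∞ r_n w^n = (∑_{n=0}^∞ r_n (1-a+aw)^n) · (∑_{m=0}^∞ h_m w^m) for all w ∈ [0,1]. -/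
open Polynomial in
/-- The coefficient of `X ^ m` in `(1 - a + a X) ^ n`, i.e. a binomial probability. -/
noncomputable def thinCoeff (a : ℝ) (n m : ℕ) : ℝ := ((C (1 - a) + C a * X) ^ n : ℝ[X]).coeff m

lemma thinCoeff_zero_left (a : ℝ) (m : ℕ) : thinCoeff a 0 m = if m = 0 then 1 else 0 := by
  simp [thinCoeff, Polynomial.coeff_one]

lemma thinCoeff_succ_zero (a : ℝ) (n : ℕ) :
    thinCoeff a (n + 1) 0 = (1 - a) * thinCoeff a n 0 := by
  simp [thinCoeff, pow_succ', add_mul, Polynomial.mul_coeff_zero]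

lemma thinCoeff_succ_succ (a : ℝ) (n m : ℕ) :
    thinCoeff a (n + 1) (m + 1) = (1 - a) * thinCoeff a n (m + 1) + a * thinCoeff a n m := by
  simp only [thinCoeff, pow_succ', add_mul, mul_assoc, Polynomial.coeff_add,
    Polynomial.coeff_C_mul, Polynomial.coeff_X_mul]

lemma thinCoeff_nonneg {a : ℝ} (ha : a ∈ Set.Ioo (0 : ℝ) 1) (n m : ℕ) : 0 ≤ thinCoeff a n m := by
  obtain ⟨h0, h1⟩ := ha
  induction n generalizing m with
  | zero => rw [thinCoeff_zero_left]; split_ifs <;> simp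
  | succ n ih =>
    have : 0 ≤ 1 - a := by linarith
    cases m with
    | zero => rw [thinCoeff_succ_zero]; exact mul_nonneg this (ih 0)
    | succ m =>
      rw [thinCoeff_succ_succ]
      exact add_nonneg (mul_nonneg this (ih _)) (mul_nonneg h0.le (ih _))

lemma thinCoeff_eq_zero_of_lt (a : ℝ) {n m : ℕ} (h : n < m) : thinCoeff a n m = 0 := by
  induction n generalizing m with
  | zero => rw [thinCoeff_zero_left, if_neg (by omega)]
  | succ n ih =>
    obtain ⟨m, rfl⟩ : ∃ k, m = k + 1 := ⟨m - 1, by omega⟩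
    rw [thinCoeff_succ_succ, ih (by omega), ih (by omega)]; simp

lemma thinCoeff_add (a : ℝ) (i j m : ℕ) :
    thinCoeff a (i + j) m =
      ∑ kl ∈ Finset.HasAntidiagonal.antidiagonal m, thinCoeff a i kl.1 * thinCoeff a j kl.2 := by
  simp only [thinCoeff, pow_add, Polynomial.coeff_mul]

lemma succ_mul_thinCoeff_succ (a : ℝ) (n m : ℕ) :
    ((m : ℝ) + 1) * thinCoeff a (n + 1) (m + 1) = a * (((n : ℝ) + 1) * thinCoeff a n m) := by
  have h := congrArg (fun q => Polynomial.coeff q m)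
    (Polynomial.derivative_pow_succ
      (Polynomial.C (1 - a) + Polynomial.C a * Polynomial.X : Polynomial ℝ) n)
  have h2 : (Polynomial.C ((n : ℝ) + 1) *
      (Polynomial.C (1 - a) + Polynomial.C a * Polynomial.X) ^ n * Polynomial.C a).coeff m
      = ((n : ℝ) + 1) * thinCoeff a n m * a := by
    rw [Polynomial.coeff_mul_C, Polynomial.coeff_C_mul, thinCoeff]
  simp only [Polynomial.coeff_derivative, Polynomial.derivative_add, Polynomial.derivative_C,
    Polynomial.derivative_mul, Polynomial.derivative_X, zero_mul, zero_add, mul_one] at h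
  rw [h2] at h
  rw [thinCoeff, mul_comm, h]; ring

lemma hasSum_thinCoeff_mul_pow (a w : ℝ) (n : ℕ) :
    HasSum (fun m => thinCoeff a n m * w ^ m) ((1 - a + a * w) ^ n) := by
  have h : ((1 - a + a * w) ^ n) = ∑ m ∈ Finset.range (n + 1), thinCoeff a n m * w ^ m := by
    have hd : ((Polynomial.C (1 - a) + Polynomial.C a * Polynomial.X) ^ n :
        Polynomial ℝ).natDegree < n + 1 := by
      rw [Nat.lt_succ_iff]
      refine Polynomial.natDegree_le_iff_coeff_eq_zero.2 fun m hm => ?_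
      exact thinCoeff_eq_zero_of_lt a hm
    have := Polynomial.eval_eq_sum_range' hd w
    simpa [thinCoeff] using this
  rw [h]
  refine hasSum_sum_of_ne_finset_zero fun m hm => ?_
  rw [thinCoeff_eq_zero_of_lt a (by simpa using hm), zero_mul]

lemma mul_sum_range_thinCoeff_le_one {a : ℝ} (ha : a ∈ Set.Ioo (0 : ℝ) 1) (m N : ℕ) :
    a * ∑ n ∈ Finset.range N, thinCoeff a n m ≤ 1 := by
  have key : ∀ m N : ℕ, a * ∑ n ∈ Finset.range N, thinCoeff a n m
      = 1 - ∑ i ∈ Finset.range (m + 1), thinCoeff a N i := by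
    intro m N
    induction N with
    | zero => simp [thinCoeff_zero_left]
    | succ N ih =>
      rw [Finset.sum_range_succ, mul_add, ih,
        Finset.sum_range_succ' (fun i => thinCoeff a (N + 1) i) m, Finset.sum_congr rfl
        (fun i _ => thinCoeff_succ_succ a N i), Finset.sum_add_distrib, ← Finset.mul_sum,
        ← Finset.mul_sum, thinCoeff_succ_zero]
      have e1 := Finset.sum_range_succ (fun i => thinCoeff a N i) m
      have e2 := Finset.sum_range_succ' (fun i => thinCoeff a N i) m
      linear_combination (-a) * e1 + (a - 1) * e2
  rw [key]
  have : 0 ≤ ∑ i ∈ Finset.range (m + 1), thinCoeff a N i :=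
    Finset.sum_nonneg fun i _ => thinCoeff_nonneg ha N i
  linarith

lemma summable_thinCoeff {a : ℝ} (ha : a ∈ Set.Ioo (0 : ℝ) 1) (m : ℕ) :
    Summable fun n => thinCoeff a n m := by
  refine summable_of_sum_range_le (c := 1 / a) (fun n => thinCoeff_nonneg ha n m) fun N => ?_
  rw [le_div_iff₀ ha.1, mul_comm]
  exact mul_sum_range_thinCoeff_le_one ha m N

lemma mul_tsum_thinCoeff_le_one {a : ℝ} (ha : a ∈ Set.Ioo (0 : ℝ) 1) (m : ℕ) :
    a * ∑' n, thinCoeff a n m ≤ 1 := by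
  have : ∑' n, thinCoeff a n m ≤ 1 / a := by
    refine Real.tsum_le_of_sum_range_le (fun n => thinCoeff_nonneg ha n m) fun N => ?_
    rw [le_div_iff₀ ha.1, mul_comm]
    exact mul_sum_range_thinCoeff_le_one ha m N
  rwa [le_div_iff₀ ha.1, mul_comm] at this

/-- The expansion at `0` of `F (1 - a + a X)`. -/
noncomputable def thin (a : ℝ) (F : PowerSeries ℝ) : PowerSeries ℝ :=
  PowerSeries.mk fun m => ∑' n, PowerSeries.coeff n F * thinCoeff a n m

lemma coeff_thin (a : ℝ) (F : PowerSeries ℝ) (m : ℕ) :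
    PowerSeries.coeff m (thin a F) = ∑' n, PowerSeries.coeff n F * thinCoeff a n m :=
  PowerSeries.coeff_mk _ _

lemma summable_mul_thinCoeff {a : ℝ} (ha : a ∈ Set.Ioo (0 : ℝ) 1) {x : ℕ → ℝ} {M : ℝ}
    (hx0 : ∀ n, 0 ≤ x n) (hx : ∀ n, x n ≤ M) (m : ℕ) :
    Summable fun n => x n * thinCoeff a n m :=
  Summable.of_nonneg_of_le (fun n => mul_nonneg (hx0 n) (thinCoeff_nonneg ha n m))
    (fun n => mul_le_mul_of_nonneg_right (hx n) (thinCoeff_nonneg ha n m))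
    ((summable_thinCoeff ha m).mul_left M)

lemma thin_mul {a : ℝ} {F G : PowerSeries ℝ}
    (hF : ∀ m, Summable fun n => PowerSeries.coeff n F * thinCoeff a n m)
    (hG : ∀ m, Summable fun n => PowerSeries.coeff n G * thinCoeff a n m) :
    thin a (F * G) = thin a F * thin a G := by
  ext m
  have hprod : ∀ kl : ℕ × ℕ, HasSum (fun n => ∑ ij ∈ Finset.HasAntidiagonal.antidiagonal n,
      (PowerSeries.coeff ij.1 F * thinCoeff a ij.1 kl.1) *
        (PowerSeries.coeff ij.2 G * thinCoeff a ij.2 kl.2))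
      (PowerSeries.coeff kl.1 (thin a F) * PowerSeries.coeff kl.2 (thin a G)) := fun kl => by
    have hs := (summable_norm_sum_mul_antidiagonal_of_summable_norm
      (hF kl.1).norm (hG kl.2).norm).of_norm
    have ht := tsum_mul_tsum_eq_tsum_sum_antidiagonal_of_summable_norm
      (hF kl.1).norm (hG kl.2).norm
    rw [coeff_thin, coeff_thin, ht]
    exact hs.hasSum
  have hsum := hasSum_sum (s := Finset.HasAntidiagonal.antidiagonal m) fun kl _ => hprod kl
  rw [coeff_thin, PowerSeries.coeff_mul, ← hsum.tsum_eq]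
  refine tsum_congr fun n => ?_
  rw [Finset.sum_comm, PowerSeries.coeff_mul, Finset.sum_mul]
  refine Finset.sum_congr rfl fun ij hij => ?_
  rw [← Finset.HasAntidiagonal.mem_antidiagonal.1 hij, thinCoeff_add, Finset.mul_sum]
  refine Finset.sum_congr rfl fun kl _ => ?_
  ring

lemma derivative_thin {a : ℝ} {F : PowerSeries ℝ}
    (hF : ∀ m, Summable fun n => PowerSeries.coeff n F * thinCoeff a n m) :
    PowerSeries.derivative ℝ (thin a F) =
      PowerSeries.C a * thin a (PowerSeries.derivative ℝ F) := by
  ext m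
  rw [PowerSeries.coeff_derivative, PowerSeries.coeff_C_mul, coeff_thin, coeff_thin,
    (hF (m + 1)).tsum_eq_zero_add, thinCoeff_eq_zero_of_lt a (Nat.succ_pos m), mul_zero, zero_add,
    ← tsum_mul_right, ← tsum_mul_left]
  refine tsum_congr fun n => ?_
  rw [PowerSeries.coeff_derivative]
  linear_combination PowerSeries.coeff (n + 1) F * succ_mul_thinCoeff_succ a n m

lemma hasSum_coeff_thin_mul_pow {a w : ℝ} (ha : a ∈ Set.Ioo (0 : ℝ) 1)
    (hw : w ∈ Set.Icc (0 : ℝ) 1) {r : ℕ → ℝ} (hr0 : ∀ n, 0 ≤ r n) (hr : Summable r) :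
    HasSum (fun m => PowerSeries.coeff m (thin a (PowerSeries.mk r)) * w ^ m)
      (∑' n, r n * (1 - a + a * w) ^ n) := by
  have hv0 : 0 ≤ 1 - a + a * w := by nlinarith [ha.1, ha.2, hw.1]
  have hv1 : 1 - a + a * w ≤ 1 := by nlinarith [ha.1, ha.2, hw.2]
  set f : ℕ × ℕ → ℝ := fun q => r q.1 * (thinCoeff a q.1 q.2 * w ^ q.2) with hf
  have hrow : ∀ n, HasSum (fun m => f (n, m)) (r n * (1 - a + a * w) ^ n) := fun n =>
    (hasSum_thinCoeff_mul_pow a w n).mul_left (r n)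
  have hrv : Summable fun n => r n * (1 - a + a * w) ^ n :=
    Summable.of_nonneg_of_le (fun n => mul_nonneg (hr0 n) (pow_nonneg hv0 n))
      (fun n => mul_le_of_le_one_right (hr0 n) (pow_le_one₀ hv0 hv1)) hr
  have hfs : Summable f := by
    refine (summable_prod_of_nonneg fun q => mul_nonneg (hr0 _)
      (mul_nonneg (thinCoeff_nonneg ha _ _) (pow_nonneg hw.1 _))).2
        ⟨fun n => (hrow n).summable, ?_⟩
    exact hrv.congr fun n => (hrow n).tsum_eq.symm
  have hsum : HasSum f (∑' n, r n * (1 - a + a * w) ^ n) := by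
    have h := hfs.hasSum
    rwa [hfs.tsum_prod, tsum_congr fun n => (hrow n).tsum_eq] at h
  have hswap : HasSum (fun q : ℕ × ℕ => f q.swap) (∑' n, r n * (1 - a + a * w) ^ n) :=
    (Equiv.prodComm ℕ ℕ).hasSum_iff.2 hsum
  have hcol := hswap.prod_fiberwise fun m => (hswap.summable.prod_factor m).hasSum
  convert hcol using 2 with m
  rw [coeff_thin, ← tsum_mul_right]
  exact tsum_congr fun n => by simp [hf, mul_assoc]

/-- **Kaluza's theorem**: the reciprocal of a power series with positive log-convex coefficients
has nonpositive coefficients in positive degrees. -/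
lemma coeff_nonneg_of_logConvex {r u q : ℕ → ℝ} (hr : ∀ n, 0 < r n)
    (hq : ∀ n, r (n + 1) = q n * r n) (hmono : Monotone q)
    (hu : ∀ n, r (n + 1) = ∑ ij ∈ Finset.HasAntidiagonal.antidiagonal n, u ij.1 * r ij.2) (n : ℕ) :
    0 ≤ u n := by
  induction n using Nat.strong_induction_on with
  | _ n ih =>
    rcases n with _ | n
    · have h := hu 0
      simp only [Finset.Nat.antidiagonal_zero, Finset.sum_singleton] at h
      exact nonneg_of_mul_nonneg_left (h ▸ (hr _).le) (hr 0)
    · have h := hu (n + 1)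
      rw [Finset.Nat.sum_antidiagonal_succ'] at h
      have hle : ∑ ij ∈ Finset.HasAntidiagonal.antidiagonal n, u ij.1 * r (ij.2 + 1)
          ≤ q (n + 1) * ∑ ij ∈ Finset.HasAntidiagonal.antidiagonal n, u ij.1 * r ij.2 := by
        rw [Finset.mul_sum]
        refine Finset.sum_le_sum fun ij hij => ?_
        have hij' := Finset.HasAntidiagonal.mem_antidiagonal.1 hij
        rw [hq ij.2]
        have h1 : q ij.2 ≤ q (n + 1) := hmono (by omega)
        nlinarith [mul_le_mul_of_nonneg_right h1 (mul_nonneg (ih ij.1 (by omega)) (hr ij.2).le)]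
      rw [← hu n, ← hq (n + 1)] at hle
      refine nonneg_of_mul_nonneg_left (b := r 0) ?_ (hr 0)
      dsimp only at h
      linarith

lemma coeff_mul_nonneg {F G : PowerSeries ℝ} (hF : ∀ n, 0 ≤ PowerSeries.coeff n F)
    (hG : ∀ n, 0 ≤ PowerSeries.coeff n G) (n : ℕ) : 0 ≤ PowerSeries.coeff n (F * G) := by
  rw [PowerSeries.coeff_mul]
  exact Finset.sum_nonneg fun ij _ => mul_nonneg (hF _) (hG _)

/-- A power series with nonnegative logarithmic derivative has nonnegative coefficients. -/
lemma coeff_nonneg_of_derivative_eq_mul {D H : PowerSeries ℝ}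
    (hD : ∀ n, 0 ≤ PowerSeries.coeff n D) (h0 : 0 ≤ PowerSeries.coeff 0 H)
    (h : PowerSeries.derivative ℝ H = D * H) (n : ℕ) : 0 ≤ PowerSeries.coeff n H := by
  induction n using Nat.strong_induction_on with
  | _ n ih =>
    rcases n with _ | n
    · exact h0
    · have hn := congrArg (PowerSeries.coeff n) h
      rw [PowerSeries.coeff_derivative, PowerSeries.coeff_mul] at hn
      refine nonneg_of_mul_nonneg_left (b := (n : ℝ) + 1) ?_ (by positivity)
      rw [hn]
      refine Finset.sum_nonneg fun ij hij => mul_nonneg (hD _) (ih _ ?_)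
      have := Finset.HasAntidiagonal.mem_antidiagonal.1 hij
      omega

/-- If the logarithmic derivative `K` of `mk r` has nonnegative antitone coefficients, then `r` is
self-decomposable. -/
lemma exists_factor_of_antitone_logDeriv {r : ℕ → ℝ} (hr : ∀ n, 0 < r n) (hrs : Summable r)
    {K : PowerSeries ℝ} (hK : PowerSeries.derivative ℝ (PowerSeries.mk r) = K * PowerSeries.mk r)
    (hK0 : ∀ n, 0 ≤ PowerSeries.coeff n K) (hanti : Antitone fun n => PowerSeries.coeff n K)
    {a : ℝ} (ha : a ∈ Set.Ioo (0 : ℝ) 1) :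
    ∃ h : ℕ → ℝ, (∀ m, 0 ≤ h m) ∧ (∑' m, h m = 1) ∧
      ∀ w ∈ Set.Icc (0 : ℝ) 1,
        ∑' n : ℕ, r n * w ^ n =
          (∑' n : ℕ, r n * (1 - a + a * w) ^ n) * ∑' m : ℕ, h m * w ^ m := by
  set G : PowerSeries ℝ := PowerSeries.mk r with hG
  have hrG : ∀ n, PowerSeries.coeff n G = r n := fun n => PowerSeries.coeff_mk _ _
  have hGs : ∀ m, Summable fun n => PowerSeries.coeff n G * thinCoeff a n m := fun m =>
    summable_mul_thinCoeff ha (M := ∑' n, r n) (fun n => by rw [hrG]; exact (hr n).le)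
      (fun n => by rw [hrG]; exact hrs.le_tsum n fun j _ => (hr j).le) m
  have hKs : ∀ m, Summable fun n => PowerSeries.coeff n K * thinCoeff a n m := fun m =>
    summable_mul_thinCoeff ha hK0 (fun n => hanti (Nat.zero_le n)) m
  have ht0 : ∀ m, 0 ≤ PowerSeries.coeff m (thin a G) := fun m => by
    rw [coeff_thin]
    exact tsum_nonneg fun n => mul_nonneg (by rw [hrG]; exact (hr n).le) (thinCoeff_nonneg ha n m)
  have htpos : 0 < PowerSeries.coeff 0 (thin a G) := by
    rw [coeff_thin]
    refine (hGs 0).tsum_pos (fun n => mul_nonneg (by rw [hrG]; exact (hr n).le)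
      (thinCoeff_nonneg ha n 0)) 0 ?_
    simpa [hrG, thinCoeff_zero_left] using hr 0
  have htne : PowerSeries.constantCoeff (thin a G) ≠ 0 := by
    rw [← PowerSeries.coeff_zero_eq_constantCoeff_apply]; exact htpos.ne'
  set H : PowerSeries ℝ := G * (thin a G)⁻¹ with hH
  have hGH : G = thin a G * H := by
    rw [hH, mul_left_comm, PowerSeries.mul_inv_cancel _ htne, mul_one]
  have hHderiv : PowerSeries.derivative ℝ H = (K - PowerSeries.C a * thin a K) * H := by
    have hne : thin a G ≠ 0 := fun h0 => htne (by rw [h0, map_zero])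
    have h1 : PowerSeries.derivative ℝ G = thin a G * PowerSeries.derivative ℝ H +
        H * PowerSeries.derivative ℝ (thin a G) := by
      conv_lhs => rw [hGH]
      simp [Derivation.leibniz]
    rw [derivative_thin hGs, hK, thin_mul hKs hGs] at h1
    refine mul_left_cancel₀ hne ?_
    linear_combination (-1 : PowerSeries ℝ) * h1 + K * hGH
  have hD : ∀ m, 0 ≤ PowerSeries.coeff m (K - PowerSeries.C a * thin a K) := fun m => by
    rw [map_sub, PowerSeries.coeff_C_mul, coeff_thin, sub_nonneg]
    have h1 : ∑' n, PowerSeries.coeff n K * thinCoeff a n m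
        ≤ ∑' n, PowerSeries.coeff m K * thinCoeff a n m := by
      refine (hKs m).tsum_le_tsum (fun n => ?_) ((summable_thinCoeff ha m).mul_left _)
      rcases lt_or_ge n m with h | h
      · simp [thinCoeff_eq_zero_of_lt a h]
      · exact mul_le_mul_of_nonneg_right (hanti h) (thinCoeff_nonneg ha n m)
    rw [tsum_mul_left] at h1
    have h2 := mul_le_mul_of_nonneg_left h1 ha.1.le
    have h3 := mul_le_mul_of_nonneg_left (mul_tsum_thinCoeff_le_one ha m) (hK0 m)
    linarith
  have hmul : ∀ n, r n = ∑ ij ∈ Finset.HasAntidiagonal.antidiagonal n,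
      PowerSeries.coeff ij.1 (thin a G) * PowerSeries.coeff ij.2 H := fun n => by
    rw [← hrG n, ← PowerSeries.coeff_mul, ← hGH]
  have hH00 : 0 ≤ PowerSeries.coeff 0 H := by
    have h := hmul 0
    simp only [Finset.Nat.antidiagonal_zero, Finset.sum_singleton] at h
    exact nonneg_of_mul_nonneg_right (h ▸ (hr 0).le) htpos
  have hH0 := coeff_nonneg_of_derivative_eq_mul hD hH00 hHderiv
  have hHs : Summable fun m => PowerSeries.coeff m H := by
    refine Summable.of_nonneg_of_le hH0 (fun m => ?_)
      (hrs.mul_left (PowerSeries.coeff 0 (thin a G))⁻¹)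
    rw [inv_mul_eq_div, le_div_iff₀ htpos, mul_comm, hmul m]
    exact Finset.single_le_sum (f := fun ij : ℕ × ℕ =>
      PowerSeries.coeff ij.1 (thin a G) * PowerSeries.coeff ij.2 H)
      (fun ij _ => mul_nonneg (ht0 _) (hH0 _))
      (a := (0, m)) (by simp)
  have hfac : ∀ w ∈ Set.Icc (0 : ℝ) 1, ∑' n : ℕ, r n * w ^ n =
      (∑' n : ℕ, r n * (1 - a + a * w) ^ n) * ∑' m : ℕ, PowerSeries.coeff m H * w ^ m := by
    intro w hw
    have ht := hasSum_coeff_thin_mul_pow ha hw (fun n => (hr n).le) hrs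
    have hHw : Summable fun m => PowerSeries.coeff m H * w ^ m :=
      Summable.of_nonneg_of_le (fun m => mul_nonneg (hH0 m) (pow_nonneg hw.1 m))
        (fun m => mul_le_of_le_one_right (hH0 m) (pow_le_one₀ hw.1 hw.2)) hHs
    rw [← ht.tsum_eq,
      tsum_mul_tsum_eq_tsum_sum_antidiagonal_of_summable_norm ht.summable.norm hHw.norm]
    refine tsum_congr fun n => ?_
    rw [hmul n, Finset.sum_mul]
    refine Finset.sum_congr rfl fun ij hij => ?_
    rw [← Finset.HasAntidiagonal.mem_antidiagonal.1 hij, pow_add]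
    ring
  refine ⟨fun m => PowerSeries.coeff m H, hH0, ?_, hfac⟩
  have h1 := hfac 1 ⟨zero_le_one, le_rfl⟩
  simp only [one_pow, mul_one, sub_add_cancel] at h1
  have hpos : 0 < ∑' n, r n := hrs.tsum_pos (fun n => (hr n).le) 0 (hr 0)
  exact mul_left_cancel₀ hpos.ne' (by rw [← h1, mul_one])

/-- The logarithmic derivative of a shifted extended Sibuya generating function has nonnegative
antitone coefficients. -/
lemma exists_antitone_logDeriv_of_sibuya {b γ : ℝ} (hb : b ∈ Set.Ioc (0 : ℝ) 1)
    (hγ : γ ∈ Set.Ioo (0 : ℝ) 1) {r : ℕ → ℝ} (hr : ∀ n, 0 < r n)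
    (hrec : ∀ n : ℕ, ((n : ℝ) + 2) * r (n + 1) = b * ((n : ℝ) + 1 - γ) * r n) :
    ∃ K : PowerSeries ℝ,
      PowerSeries.derivative ℝ (PowerSeries.mk r) = K * PowerSeries.mk r ∧
      (∀ n, 0 ≤ PowerSeries.coeff n K) ∧ Antitone fun n => PowerSeries.coeff n K := by
  set G : PowerSeries ℝ := PowerSeries.mk r with hG
  have hrG : ∀ n, PowerSeries.coeff n G = r n := fun n => PowerSeries.coeff_mk _ _
  have hG0 : PowerSeries.constantCoeff G = r 0 := by
    rw [← PowerSeries.coeff_zero_eq_constantCoeff_apply, hrG]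
  have hGne : PowerSeries.constantCoeff G ≠ 0 := hG0 ▸ (hr 0).ne'
  have hGinv : G * G⁻¹ = 1 := PowerSeries.mul_inv_cancel _ hGne
  -- `V` is determined by `G = r 0 + X * V * G`
  obtain ⟨V, hV⟩ : ∃ V : PowerSeries ℝ, G - PowerSeries.C (r 0) = PowerSeries.X * V := by
    refine PowerSeries.X_dvd_iff.2 ?_
    simp [hG0]
  set U : PowerSeries ℝ := V * G⁻¹ with hU
  have hUG : V = U * G := by rw [hU, mul_assoc, mul_comm G⁻¹, hGinv, mul_one]
  have hVc : ∀ n, PowerSeries.coeff n V = r (n + 1) := fun n => by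
    rw [← PowerSeries.coeff_succ_X_mul, ← hV, map_sub, hrG, PowerSeries.coeff_C]
    simp
  have hU0 : ∀ n, 0 ≤ PowerSeries.coeff n U := by
    refine coeff_nonneg_of_logConvex (q := fun n : ℕ => b * ((n : ℝ) + 1 - γ) / ((n : ℝ) + 2)) hr
      (fun n => ?_) (monotone_nat_of_le_succ fun n => ?_) (fun n => ?_)
    · have h2 : (n : ℝ) + 2 ≠ 0 := by positivity
      rw [div_mul_eq_mul_div, eq_div_iff h2, ← hrec n]; ring
    · push_cast
      rw [div_le_div_iff₀ (by positivity) (by positivity)]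
      have := mul_pos hb.1 (add_pos hγ.1 one_pos)
      nlinarith
    · rw [← hVc n, hUG, PowerSeries.coeff_mul]
      simp [hrG]
  set K : PowerSeries ℝ := PowerSeries.derivative ℝ G * G⁻¹ with hKdef
  have hK : PowerSeries.derivative ℝ G = K * G := by
    rw [hKdef, mul_assoc, mul_comm G⁻¹, hGinv, mul_one]
  have hGV : G - PowerSeries.C (r 0) = PowerSeries.X * U * G := by
    rw [mul_assoc, ← hUG, hV]
  have hr0C : PowerSeries.C (r 0) * PowerSeries.C (r 0)⁻¹ = (1 : PowerSeries ℝ) := by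
    rw [← map_mul, mul_inv_cancel₀ (hr 0).ne', map_one]
  have hne : G ≠ 0 := fun h0 => hGne (by rw [h0, map_zero])
  have hK' : K = PowerSeries.C (r 0)⁻¹ * (PowerSeries.derivative ℝ (PowerSeries.X * U) * G) := by
    have h1 := congrArg (PowerSeries.derivative ℝ) hGV
    rw [map_sub, PowerSeries.derivative_C, sub_zero, Derivation.leibniz, smul_eq_mul, smul_eq_mul,
      hK] at h1
    have h2 : PowerSeries.C (r 0) * K = PowerSeries.derivative ℝ (PowerSeries.X * U) * G := by
      refine mul_right_cancel₀ hne ?_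
      linear_combination G * h1 - K * G * hGV
    rw [← h2, ← mul_assoc, mul_comm (PowerSeries.C (r 0)⁻¹), hr0C, one_mul]
  have hK0 : ∀ n, 0 ≤ PowerSeries.coeff n K := fun n => by
    rw [hK', PowerSeries.coeff_C_mul]
    refine mul_nonneg (inv_nonneg.2 (hr 0).le) (coeff_mul_nonneg (fun m => ?_) (fun m => ?_) n)
    · rw [PowerSeries.coeff_derivative, PowerSeries.coeff_succ_X_mul]
      exact mul_nonneg (hU0 m) (by positivity)
    · rw [hrG]; exact (hr m).le
  have hODE : K - PowerSeries.C b * (PowerSeries.X * K) = PowerSeries.C (b * (1 - γ)) - U := by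
    refine mul_right_cancel₀ hne ?_
    have h1 : (K - PowerSeries.C b * (PowerSeries.X * K)) * G =
        PowerSeries.derivative ℝ G -
          PowerSeries.C b * (PowerSeries.X * PowerSeries.derivative ℝ G) := by
      rw [hK]; ring
    rw [h1, sub_mul, ← hUG]
    ext n
    simp only [map_sub, PowerSeries.coeff_C_mul, hVc, hrG, PowerSeries.coeff_derivative]
    have h2 : PowerSeries.coeff n (PowerSeries.X * PowerSeries.derivative ℝ G) = n * r n := by
      cases n with
      | zero => simp
      | succ n =>
        rw [PowerSeries.coeff_succ_X_mul, PowerSeries.coeff_derivative, hrG]; push_cast; ring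
    rw [h2]
    linear_combination hrec n
  refine ⟨K, hK, hK0, antitone_nat_of_succ_le fun n => ?_⟩
  have h := congrArg (PowerSeries.coeff (n + 1)) hODE
  rw [map_sub, map_sub, PowerSeries.coeff_C_mul, PowerSeries.coeff_succ_X_mul,
    PowerSeries.coeff_C, if_neg (Nat.succ_ne_zero n)] at h
  have h1 := mul_le_mul_of_nonneg_right hb.2 (hK0 n)
  linarith [hU0 (n + 1)]

lemma summable_of_sibuya {b γ : ℝ} (hb : b ∈ Set.Ioc (0 : ℝ) 1)
    (hγ : γ ∈ Set.Ioo (0 : ℝ) 1) {r : ℕ → ℝ} (hr : ∀ n, 0 < r n)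
    (hrec : ∀ n : ℕ, ((n : ℝ) + 2) * r (n + 1) = b * ((n : ℝ) + 1 - γ) * r n) : Summable r := by
  have key : ∀ N : ℕ, γ * ∑ n ∈ Finset.range N, r n ≤ r 0 - ((N : ℝ) + 1) * r N := by
    intro N
    induction N with
    | zero => simp
    | succ N ih =>
      rw [Finset.sum_range_succ]
      push_cast
      have h1 : 0 ≤ ((N : ℝ) + 1 - γ) * r N :=
        mul_nonneg (by linarith [hγ.2, Nat.cast_nonneg (α := ℝ) N]) (hr N).le
      have h2 := mul_le_mul_of_nonneg_right hb.2 h1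
      linarith [hrec N]
  refine summable_of_sum_range_le (c := r 0 / γ) (fun n => (hr n).le) fun N => ?_
  rw [le_div_iff₀ hγ.1, mul_comm]
  have := mul_nonneg (add_nonneg (Nat.cast_nonneg (α := ℝ) N) zero_le_one) (hr N).le
  linarith [key N]

/-- The shifted extended Sibuya distribution is self-decomposable. -/
theorem stmt_14 (b γ : ℝ) (hb : b ∈ Set.Ioc (0:ℝ) 1) (hγ : γ ∈ Set.Ioo (0:ℝ) 1)
    (p : ℕ → ℝ) (hp0 : p 0 = 0)
    (hp1 : p 1 = b * γ / (1 - (1 - b) ^ γ))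
    (hrec : ∀ n : ℕ, 1 ≤ n → p (n + 1) = b * ((n : ℝ) - γ) * p n / ((n : ℝ) + 1))
    (r : ℕ → ℝ) (hr : ∀ n, r n = p (n + 1)) :
    ∀ a ∈ Set.Ioo (0:ℝ) 1, ∃ h : ℕ → ℝ, (∀ m, 0 ≤ h m) ∧ (∑' m, h m = 1) ∧
      ∀ w ∈ Set.Icc (0:ℝ) 1,
        ∑' n : ℕ, r n * w ^ n =
          (∑' n : ℕ, r n * (1 - a + a * w) ^ n) * ∑' m : ℕ, h m * w ^ m := by
  have hrec' : ∀ n : ℕ, ((n : ℝ) + 2) * r (n + 1) = b * ((n : ℝ) + 1 - γ) * r n := by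
    intro n
    have h2 : (n : ℝ) + 1 + 1 ≠ 0 := by positivity
    rw [hr, hr, hrec (n + 1) (by omega)]
    push_cast
    field_simp
    ring
  have hpos : ∀ n, 0 < r n := by
    intro n
    induction n with
    | zero =>
      rw [hr, zero_add, hp1]
      have : (1 - b) ^ γ < 1 :=
        Real.rpow_lt_one (by linarith [hb.2]) (by linarith [hb.1]) hγ.1
      exact div_pos (mul_pos hb.1 hγ.1) (by linarith)
    | succ n ih =>
      refine pos_of_mul_pos_right (a := (n : ℝ) + 2) ?_ (by positivity)
      rw [hrec' n]
      exact mul_pos (mul_pos hb.1 (by linarith [hγ.2, Nat.cast_nonneg (α := ℝ) n])) ih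
  obtain ⟨K, hK, hK0, hanti⟩ := exists_antitone_logDeriv_of_sibuya hb hγ hpos hrec'
  intro a ha
  exact exists_factor_of_antitone_logDeriv hpos (summable_of_sibuya hb hγ hpos hrec') hK hK0
    hanti ha
end

section
/- Let r : ℕ → (0,∞) be a strictly decreasing probability mass function (∑ r_n = 1, r_{n+1} < r_n for all n) satisfying, for every j ∈ ℕ, max_{0 ≤ n ≤ j} (r_{n+1}/r_n) ≤ ((j+2)/(j+1)) · (r_{j+1}-r_{j+2})/(r_j-r_{j+1}). Then the distribution with pmf r is discrete self-decomposable: for every a ∈ (0,1) there exists a probability mass function h with ∑_{n=0}^∞ r_n w^n = (∑_{n=0}^∞ r_n (1-a+aw)^n) · (∑_{m=0}^∞ h_m w^m) for all w ∈ [0,1]. -/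
open Finset PowerSeries

/-- The binomial weight `C(n, m) a ^ m (1 - a) ^ (n - m)`, as a coefficient of `(1 - a + a X) ^ n`. -/
noncomputable def binomWeight (a : ℝ) (n m : ℕ) : ℝ :=
  ((Polynomial.C (1 - a) + Polynomial.C a * Polynomial.X) ^ n).coeff m

/-- Binomial thinning of a sequence. -/
noncomputable def binomThin (a : ℝ) (x : ℕ → ℝ) (m : ℕ) : ℝ :=
  ∑' n, x n * binomWeight a n m

section Weights

variable {a : ℝ}

lemma binomWeight_eq_zero {n m : ℕ} (h : n < m) : binomWeight a n m = 0 := by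
  refine Polynomial.coeff_eq_zero_of_natDegree_lt (lt_of_le_of_lt ?_ h)
  have h1 : (Polynomial.C (1 - a) + Polynomial.C a * Polynomial.X).natDegree ≤ 1 := by
    compute_degree
  simpa using Polynomial.natDegree_pow_le_of_le n h1

lemma sum_binomWeight_mul_pow (w : ℝ) {n N : ℕ} (h : n < N) :
    ∑ m ∈ range N, binomWeight a n m * w ^ m = (1 - a + a * w) ^ n := by
  have h1 : (Polynomial.C (1 - a) + Polynomial.C a * Polynomial.X).natDegree ≤ 1 := by
    compute_degree
  have h2 : ((Polynomial.C (1 - a) + Polynomial.C a * Polynomial.X) ^ n).natDegree < N :=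
    lt_of_le_of_lt (by simpa using Polynomial.natDegree_pow_le_of_le n h1) h
  have := Polynomial.eval_eq_sum_range' h2 w
  simpa [binomWeight] using this.symm

lemma hasSum_binomWeight_mul_pow (w : ℝ) (n : ℕ) :
    HasSum (fun m => binomWeight a n m * w ^ m) ((1 - a + a * w) ^ n) := by
  rw [← sum_binomWeight_mul_pow w (Nat.lt_succ_self n)]
  refine hasSum_sum_of_ne_finset_zero fun m hm => ?_
  rw [binomWeight_eq_zero (by simpa using hm), zero_mul]

lemma sum_binomWeight {n N : ℕ} (h : n < N) : ∑ m ∈ range N, binomWeight a n m = 1 := by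
  simpa using sum_binomWeight_mul_pow (a := a) 1 h

lemma binomWeight_succ_succ (n m : ℕ) :
    binomWeight a (n + 1) (m + 1) = (1 - a) * binomWeight a n (m + 1) + a * binomWeight a n m := by
  unfold binomWeight
  rw [pow_succ', add_mul, mul_assoc, Polynomial.coeff_add, Polynomial.coeff_C_mul,
    Polynomial.coeff_C_mul, Polynomial.coeff_X_mul]

lemma binomWeight_succ_zero (n : ℕ) :
    binomWeight a (n + 1) 0 = (1 - a) * binomWeight a n 0 := by
  unfold binomWeight
  rw [pow_succ', add_mul, mul_assoc, Polynomial.coeff_add, Polynomial.coeff_C_mul,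
    Polynomial.coeff_C_mul, Polynomial.coeff_X_mul_zero, mul_zero, add_zero]

lemma binomWeight_nonneg (h0 : 0 ≤ a) (h1 : a ≤ 1) (n m : ℕ) : 0 ≤ binomWeight a n m := by
  induction n generalizing m with
  | zero =>
    unfold binomWeight
    rw [pow_zero, Polynomial.coeff_one]
    split_ifs <;> norm_num
  | succ n ih =>
    have h2 : 0 ≤ 1 - a := by linarith
    cases m with
    | zero => rw [binomWeight_succ_zero]; exact mul_nonneg h2 (ih 0)
    | succ m =>
      rw [binomWeight_succ_succ]
      exact add_nonneg (mul_nonneg h2 (ih _)) (mul_nonneg h0 (ih _))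

lemma binomWeight_le_one (h0 : 0 ≤ a) (h1 : a ≤ 1) (n m : ℕ) : binomWeight a n m ≤ 1 := by
  rw [← sum_binomWeight (a := a) (show n < n + m + 1 by lia)]
  exact single_le_sum (f := fun m => binomWeight a n m)
    (fun i _ => binomWeight_nonneg h0 h1 n i) (by simp)

lemma succ_mul_binomWeight_succ_succ (n m : ℕ) :
    ((m : ℝ) + 1) * binomWeight a (n + 1) (m + 1) = (n + 1) * a * binomWeight a n m := by
  have h := congrArg (fun p => Polynomial.coeff p m) (Polynomial.derivative_pow_succ
    (Polynomial.C (1 - a) + Polynomial.C a * Polynomial.X) n)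
  simp only [Polynomial.coeff_derivative, Polynomial.derivative_add, Polynomial.derivative_C,
    Polynomial.derivative_C_mul, Polynomial.derivative_X, zero_add, mul_one,
    Polynomial.coeff_mul_C] at h
  rw [Polynomial.coeff_C_mul] at h
  unfold binomWeight
  linarith

lemma succ_mul_binomWeight_succ (n m : ℕ) :
    ((m : ℝ) + 1) * (1 - a) * binomWeight a n (m + 1) = a * ((n : ℝ) - m) * binomWeight a n m := by
  have h := succ_mul_binomWeight_succ_succ (a := a) n m
  rw [binomWeight_succ_succ] at h
  linarith

lemma binomWeight_add (k l m : ℕ) :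
    binomWeight a (k + l) m =
      ∑ ij ∈ antidiagonal m, binomWeight a k ij.1 * binomWeight a l ij.2 := by
  unfold binomWeight
  rw [pow_add, Polynomial.coeff_mul]

end Weights

section Thinning

variable {a : ℝ}

lemma summable_mul_binomWeight (h0 : 0 ≤ a) (h1 : a ≤ 1) {x : ℕ → ℝ} (hx : Summable x) (m : ℕ) :
    Summable fun n => x n * binomWeight a n m := by
  refine Summable.of_norm_bounded hx.norm fun n => ?_
  rw [norm_mul, Real.norm_of_nonneg (binomWeight_nonneg h0 h1 n m)]
  exact mul_le_of_le_one_right (norm_nonneg _) (binomWeight_le_one h0 h1 n m)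

lemma binomThin_nonneg (h0 : 0 ≤ a) (h1 : a ≤ 1) {x : ℕ → ℝ} (hx : ∀ n, 0 ≤ x n) (m : ℕ) :
    0 ≤ binomThin a x m :=
  tsum_nonneg fun n => mul_nonneg (hx n) (binomWeight_nonneg h0 h1 n m)

lemma binomThin_zero_pos (h0 : 0 ≤ a) (h1 : a ≤ 1) {x : ℕ → ℝ} (hx : Summable x)
    (hn : ∀ n, 0 ≤ x n) (hp : 0 < x 0) : 0 < binomThin a x 0 := by
  refine (summable_mul_binomWeight h0 h1 hx 0).tsum_pos
    (fun n => mul_nonneg (hn n) (binomWeight_nonneg h0 h1 n 0)) 0 ?_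
  simpa [binomWeight] using hp

/-- Thinning is multiplicative for convolution. -/
lemma binomThin_conv (h0 : 0 ≤ a) (h1 : a ≤ 1) {x y : ℕ → ℝ} (hx : Summable x) (hy : Summable y)
    (m : ℕ) :
    binomThin a (fun n => ∑ kl ∈ antidiagonal n, x kl.1 * y kl.2) m =
      ∑ ij ∈ antidiagonal m, binomThin a x ij.1 * binomThin a y ij.2 := by
  have hprod : ∀ i j, HasSum (fun n => ∑ kl ∈ antidiagonal n,
      x kl.1 * binomWeight a kl.1 i * (y kl.2 * binomWeight a kl.2 j))
      (binomThin a x i * binomThin a y j) := by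
    intro i j
    have hX := (summable_mul_binomWeight h0 h1 hx i).norm
    have hY := (summable_mul_binomWeight h0 h1 hy j).norm
    unfold binomThin
    rw [tsum_mul_tsum_eq_tsum_sum_antidiagonal_of_summable_norm hX hY]
    exact (summable_norm_sum_mul_antidiagonal_of_summable_norm hX hY).of_norm.hasSum
  have hsum := hasSum_sum fun (ij : ℕ × ℕ) (_ : ij ∈ antidiagonal m) => hprod ij.1 ij.2
  rw [← hsum.tsum_eq, binomThin]
  refine tsum_congr fun n => ?_
  rw [sum_comm, sum_mul]
  refine sum_congr rfl fun kl hkl => ?_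
  rw [← mem_antidiagonal.1 hkl, binomWeight_add, mul_sum]
  exact sum_congr rfl fun ij _ => by ring

lemma hasSum_binomThin_mul_pow (h0 : 0 ≤ a) (h1 : a ≤ 1) {x : ℕ → ℝ} (hx : Summable x)
    (hn : ∀ n, 0 ≤ x n) {w : ℝ} (hw0 : 0 ≤ w) (hw1 : w ≤ 1) :
    HasSum (fun m => binomThin a x m * w ^ m) (∑' n, x n * (1 - a + a * w) ^ n) := by
  have hrow : ∀ n, HasSum (fun m => x n * binomWeight a n m * w ^ m)
      (x n * (1 - a + a * w) ^ n) := fun n => by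
    simpa only [mul_assoc] using (hasSum_binomWeight_mul_pow w n).mul_left (x n)
  have hu0 : 0 ≤ 1 - a + a * w := by nlinarith
  have hu1 : 1 - a + a * w ≤ 1 := by nlinarith
  have hs : Summable fun p : ℕ × ℕ => x p.1 * binomWeight a p.1 p.2 * w ^ p.2 := by
    rw [summable_prod_of_nonneg fun p => mul_nonneg
      (mul_nonneg (hn p.1) (binomWeight_nonneg h0 h1 _ _)) (pow_nonneg hw0 _)]
    refine ⟨fun n => (hrow n).summable, ?_⟩
    simp_rw [(hrow _).tsum_eq]
    exact Summable.of_nonneg_of_le (fun n => mul_nonneg (hn n) (pow_nonneg hu0 n))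
      (fun n => mul_le_of_le_one_right (hn n) (pow_le_one₀ hu0 hu1)) hx
  have hsw := hs.prod_symm.hasSum.prod_fiberwise fun m => (hs.prod_symm.prod_factor m).hasSum
  have e1 : (fun m => binomThin a x m * w ^ m) =
      fun m => ∑' n, x n * binomWeight a n m * w ^ m := by
    funext m
    rw [binomThin, tsum_mul_right]
  have e2 : ∑' n, x n * (1 - a + a * w) ^ n =
      ∑' p : ℕ × ℕ, x p.swap.1 * binomWeight a p.swap.1 p.swap.2 * w ^ p.swap.2 := by
    refine Eq.trans ?_ ((Equiv.prodComm ℕ ℕ).tsum_eq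
      (fun p : ℕ × ℕ => x p.1 * binomWeight a p.1 p.2 * w ^ p.2)).symm
    rw [hs.tsum_prod]
    exact tsum_congr fun n => (hrow n).tsum_eq.symm
  rw [e1, e2]
  exact hsw

lemma sum_range_le_sum_range_binomThin (h0 : 0 ≤ a) (h1 : a ≤ 1) {x : ℕ → ℝ} (hx : Summable x)
    (hn : ∀ n, 0 ≤ x n) (M : ℕ) :
    ∑ m ∈ range M, x m ≤ ∑ m ∈ range M, binomThin a x m := by
  have hs := fun m => summable_mul_binomWeight h0 h1 hx m
  unfold binomThin
  rw [← Summable.tsum_finsetSum fun m _ => hs m]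
  refine le_trans (le_of_eq ?_) ((summable_sum fun m _ => hs m).sum_le_tsum (range M)
    fun n _ => sum_nonneg fun m _ => mul_nonneg (hn n) (binomWeight_nonneg h0 h1 n m))
  refine sum_congr rfl fun n hM => ?_
  rw [← mul_sum, sum_binomWeight (mem_range.1 hM), mul_one]

/-- Thinning commutes with the operator `(1 - X) d/dX`. -/
lemma binomThin_one_sub_X_mul_deriv (h0 : 0 < a) (h1 : a ≤ 1) {x : ℕ → ℝ} (hx : Summable x)
    (hB : Summable fun n : ℕ => (n + 1) * x (n + 1) - n * x n) (m : ℕ) :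
    binomThin a (fun n : ℕ => (n + 1) * x (n + 1) - n * x n) m =
      (m + 1) * binomThin a x (m + 1) - m * binomThin a x m := by
  have s1 := (summable_mul_binomWeight h0.le h1 hB m).hasSum
  have s2 := (summable_mul_binomWeight h0.le h1 hx (m + 1)).hasSum.mul_left ((m : ℝ) + 1)
  have s3 := (summable_mul_binomWeight h0.le h1 hx m).hasSum.mul_left (m : ℝ)
  have s4 := s1.sub (s2.sub s3)
  set F : ℕ → ℝ := fun n => (m + 1) / a * (x n * binomWeight a n (m + 1)) with hF
  have hlim : Filter.Tendsto F Filter.atTop (nhds 0) := by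
    simpa using (summable_mul_binomWeight h0.le h1 hx (m + 1)).tendsto_atTop_zero.const_mul
      (((m : ℝ) + 1) / a)
  have hF0 : F 0 = 0 := by simp [hF, binomWeight_eq_zero]
  have ht := s4.tendsto_sum_nat
  have e : (fun N => ∑ n ∈ range N, (((n + 1) * x (n + 1) - n * x n) * binomWeight a n m -
      ((m + 1) * (x n * binomWeight a n (m + 1)) - m * (x n * binomWeight a n m)))) = F := by
    funext N
    rw [← sub_zero (F N), ← hF0, ← sum_range_sub]
    refine sum_congr rfl fun n _ => ?_
    have i1 := succ_mul_binomWeight_succ_succ (a := a) n m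
    have i2 := succ_mul_binomWeight_succ (a := a) n m
    simp only [hF]
    field_simp
    linear_combination (-x (n + 1)) * i1 + x n * i2
  rw [e] at ht
  have := tendsto_nhds_unique ht hlim
  unfold binomThin
  linarith

end Thinning

/-- A power series is coefficientwise nonnegative as soon as its constant coefficient and its
logarithmic derivative are. -/
lemma coeff_nonneg_of_derivative_eq_mul_s15 {H K : PowerSeries ℝ} (hK : ∀ n, 0 ≤ coeff n K)
    (h0 : 0 ≤ coeff 0 H) (hH : derivative ℝ H = K * H) (n : ℕ) : 0 ≤ coeff n H := by
  induction n using Nat.strong_induction_on with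
  | _ n ih =>
    cases n with
    | zero => exact h0
    | succ n =>
      have h := congrArg (coeff n) hH
      rw [coeff_derivative, coeff_mul] at h
      have hs : 0 ≤ ∑ p ∈ antidiagonal n, coeff p.1 K * coeff p.2 H :=
        sum_nonneg fun p hp => mul_nonneg (hK _)
          (ih _ (by have := mem_antidiagonal.1 hp; lia))
      rw [← h] at hs
      exact nonneg_of_mul_nonneg_left hs (by positivity)

lemma one_sub_X_mul_mk_sum_range (f : ℕ → ℝ) :
    (1 - X) * PowerSeries.mk (fun n => ∑ m ∈ range (n + 1), f m) = PowerSeries.mk f := by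
  ext n
  cases n with
  | zero => simp [sub_mul]
  | succ n =>
    rw [sub_mul, one_mul, map_sub, coeff_succ_X_mul]
    simp [sum_range_succ _ (n + 1)]

lemma coeff_one_sub_X_mul_derivative (f : ℕ → ℝ) (n : ℕ) :
    coeff n ((1 - X) * derivative ℝ (PowerSeries.mk f)) = (n + 1) * f (n + 1) - n * f n := by
  cases n with
  | zero =>
    rw [sub_mul, one_mul, map_sub, coeff_zero_X_mul, coeff_derivative]
    simp
  | succ n =>
    rw [sub_mul, one_mul, map_sub, coeff_succ_X_mul]
    simp only [coeff_derivative, coeff_mk]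
    push_cast
    ring

/-- A comparison criterion for nonnegativity of a deconvolution. -/
lemma nonneg_of_conv_ratio {r d A ρ : ℕ → ℝ} (hr : 0 < r 0)
    (hconv : ∀ n, ∑ kl ∈ antidiagonal n, d kl.1 * r kl.2 = A n) (hA0 : 0 ≤ A 0)
    (hρ : ∀ n, ∀ k ≤ n, r (k + 1) ≤ ρ n * r k) (hA : ∀ n, ρ n * A n ≤ A (n + 1)) (n : ℕ) :
    0 ≤ d n := by
  induction n using Nat.strong_induction_on with
  | _ n ih =>
    cases n with
    | zero =>
      have h := hconv 0
      simp only [Nat.antidiagonal_zero, sum_singleton] at h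
      exact nonneg_of_mul_nonneg_left (h ▸ hA0) hr
    | succ n =>
      have h := hconv (n + 1)
      rw [Nat.sum_antidiagonal_succ'] at h
      have hle : ∑ p ∈ antidiagonal n, d p.1 * r (p.2 + 1) ≤ ρ n * A n := by
        rw [← hconv n, mul_sum]
        refine sum_le_sum fun p hp => ?_
        have := mul_le_mul_of_nonneg_left (hρ n p.2 (by have := mem_antidiagonal.1 hp; lia))
          (ih p.1 (by have := mem_antidiagonal.1 hp; lia))
        linarith
      have := hA n
      exact nonneg_of_mul_nonneg_left (by simp only at h; linarith) hr

/-- If `(1 - X) G' = (c - D) G` with `D` coefficientwise nonnegative and summable, then the quotient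
of `G` by its binomial thinning has nonnegative coefficients. -/
lemma exists_nonneg_conv_binomThin {a c : ℝ} (h0 : 0 < a) (h1 : a ≤ 1) {r d : ℕ → ℝ}
    (hr : ∀ n, 0 < r n) (hrs : Summable r) (hd : ∀ n, 0 ≤ d n) (hds : Summable d)
    (hconv : ∀ n : ℕ, ∑ kl ∈ antidiagonal n, d kl.1 * r kl.2 =
      c * r n - ((n + 1) * r (n + 1) - n * r n)) :
    ∃ h : ℕ → ℝ, (∀ m, 0 ≤ h m) ∧
      ∀ n, ∑ kl ∈ antidiagonal n, binomThin a r kl.1 * h kl.2 = r n := by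
  have hAs : Summable fun n => ∑ kl ∈ antidiagonal n, d kl.1 * r kl.2 :=
    (summable_norm_sum_mul_antidiagonal_of_summable_norm hds.norm hrs.norm).of_norm
  have hB : Summable fun n : ℕ => (n + 1) * r (n + 1) - n * r n := by
    refine ((hrs.mul_left c).sub hAs).congr fun n => ?_
    rw [hconv n]
    ring
  have hthin : ∀ m : ℕ, ∑ kl ∈ antidiagonal m, binomThin a d kl.1 * binomThin a r kl.2 =
      c * binomThin a r m - ((m + 1) * binomThin a r (m + 1) - m * binomThin a r m) := by
    intro m
    rw [← binomThin_conv h0.le h1 hds hrs, ← binomThin_one_sub_X_mul_deriv h0 h1 hrs hB]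
    simp_rw [hconv]
    unfold binomThin
    rw [← tsum_mul_left, ← ((summable_mul_binomWeight h0.le h1 hrs m).mul_left c).tsum_sub
      (summable_mul_binomWeight h0.le h1 hB m)]
    exact tsum_congr fun n => by ring
  set G : PowerSeries ℝ := PowerSeries.mk r with hG
  set g : PowerSeries ℝ := PowerSeries.mk (binomThin a r) with hg
  have hDG : PowerSeries.mk d * G = C c * G - (1 - X) * derivative ℝ G := by
    ext n
    rw [map_sub, hG, coeff_one_sub_X_mul_derivative, coeff_mul, coeff_C_mul]
    simpa using hconv n
  have hEg : PowerSeries.mk (binomThin a d) * g = C c * g - (1 - X) * derivative ℝ g := by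
    ext n
    rw [map_sub, hg, coeff_one_sub_X_mul_derivative, coeff_mul, coeff_C_mul]
    simpa using hthin n
  have hg0 : 0 < constantCoeff g := by
    rw [← coeff_zero_eq_constantCoeff_apply, hg, coeff_mk]
    exact binomThin_zero_pos h0.le h1 hrs (fun n => (hr n).le) (hr 0)
  have hgne : g ≠ 0 := fun h => by simp [h] at hg0
  set H : PowerSeries ℝ := G * g⁻¹ with hH
  have hgH : G = g * H := by
    rw [hH, mul_left_comm, PowerSeries.mul_inv_cancel _ hg0.ne', mul_one]
  set K : PowerSeries ℝ := PowerSeries.mk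
    (fun n => ∑ m ∈ range (n + 1), (binomThin a d m - d m)) with hKdef
  have hK : (1 - X) * K = PowerSeries.mk (binomThin a d) - PowerSeries.mk d := by
    rw [hKdef, one_sub_X_mul_mk_sum_range]
    ext n
    simp
  have hX : (1 - X : PowerSeries ℝ) ≠ 0 := fun h => by
    simpa using congrArg constantCoeff h
  have hder : derivative ℝ H = K * H := by
    refine mul_left_cancel₀ (mul_ne_zero hX hgne) ?_
    have hGd : derivative ℝ G = g * derivative ℝ H + H * derivative ℝ g := by
      rw [hgH, Derivation.leibniz, smul_eq_mul, smul_eq_mul]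
    rw [hGd, hgH] at hDG
    linear_combination hDG - H * hEg - g * H * hK
  refine ⟨fun n => coeff n H, coeff_nonneg_of_derivative_eq_mul_s15 (K := K) (fun n => ?_) ?_ hder,
    fun n => ?_⟩
  · rw [hKdef, coeff_mk, sum_sub_distrib, sub_nonneg]
    exact sum_range_le_sum_range_binomThin h0.le h1 hds hd _
  · rw [hH, coeff_zero_eq_constantCoeff_apply, map_mul, constantCoeff_inv]
    refine mul_nonneg ?_ (inv_nonneg.2 hg0.le)
    simpa [hG, ← coeff_zero_eq_constantCoeff_apply] using (hr 0).le
  · have h := congrArg (coeff n) hgH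
    rw [coeff_mul] at h
    simpa [hG, hg] using h.symm

/-- A nonnegative sequence whose convolution with `g` is summable is summable if `g 0 > 0`. -/
lemma summable_of_conv {g h A : ℕ → ℝ} (hg : ∀ n, 0 ≤ g n) (hg0 : 0 < g 0) (hh : ∀ n, 0 ≤ h n)
    (hA : Summable A) (hconv : ∀ n, ∑ kl ∈ antidiagonal n, g kl.1 * h kl.2 = A n) :
    Summable h := by
  refine Summable.of_nonneg_of_le hh (fun n => ?_) (hA.mul_left (g 0)⁻¹)
  rw [← hconv n, le_inv_mul_iff₀ hg0]
  exact single_le_sum (f := fun kl : ℕ × ℕ => g kl.1 * h kl.2)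
    (fun kl _ => mul_nonneg (hg _) (hh _)) (show (0, n) ∈ antidiagonal n by simp)


/-- Bondesson's criterion: a strictly decreasing pmf satisfying the stated
inequalities is discrete self-decomposable. -/
theorem stmt_15 (r : ℕ → ℝ) (hpos : ∀ n, 0 < r n) (hsum : ∑' n, r n = 1)
    (hdec : ∀ n, r (n + 1) < r n)
    (hcrit : ∀ j : ℕ, ∀ n ≤ j,
      r (n + 1) / r n ≤
        (((j : ℝ) + 2) / ((j : ℝ) + 1)) * ((r (j + 1) - r (j + 2)) / (r j - r (j + 1)))) :
    ∀ a ∈ Set.Ioo (0:ℝ) 1, ∃ h : ℕ → ℝ, (∀ m, 0 ≤ h m) ∧ (∑' m, h m = 1) ∧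
      ∀ w ∈ Set.Icc (0:ℝ) 1,
        ∑' n : ℕ, r n * w ^ n =
          (∑' n : ℕ, r n * (1 - a + a * w) ^ n) * ∑' m : ℕ, h m * w ^ m := by
  intro a ha
  obtain ⟨ha0, ha1⟩ := ha
  have hrs : Summable r := by
    by_contra h
    rw [tsum_eq_zero_of_not_summable h] at hsum
    exact zero_ne_one hsum
  set c : ℝ := r 1 / r 0 with hc
  have hc1 : c < 1 := (div_lt_one (hpos 0)).2 (hdec 0)
  have hcr : c * r 0 = r 1 := div_mul_cancel₀ _ (hpos 0).ne'
  set D : PowerSeries ℝ :=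
    (C c * PowerSeries.mk r - (1 - X) * derivative ℝ (PowerSeries.mk r)) * (PowerSeries.mk r)⁻¹ with hD
  have hr0 : constantCoeff (PowerSeries.mk r) ≠ 0 := by
    rw [← coeff_zero_eq_constantCoeff_apply, coeff_mk]
    exact (hpos 0).ne'
  have hconv : ∀ n : ℕ, ∑ kl ∈ antidiagonal n, coeff kl.1 D * r kl.2 =
      c * r n - ((n + 1) * r (n + 1) - n * r n) := by
    intro n
    have h : D * PowerSeries.mk r =
        C c * PowerSeries.mk r - (1 - X) * derivative ℝ (PowerSeries.mk r) := by
      rw [hD, mul_assoc, PowerSeries.inv_mul_cancel _ hr0, mul_one]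
    have h' := congrArg (coeff n) h
    rw [map_sub, coeff_one_sub_X_mul_derivative, coeff_mul, coeff_C_mul] at h'
    simpa using h'
  have hρ : ∀ n : ℕ, ∀ k ≤ n, r (k + 1) ≤
      (((n : ℝ) + 2) / ((n : ℝ) + 1)) * ((r (n + 1) - r (n + 2)) / (r n - r (n + 1))) * r k :=
    fun n k hk => (div_le_iff₀ (hpos k)).1 (hcrit n k hk)
  have hd : ∀ n, 0 ≤ coeff n D := by
    refine nonneg_of_conv_ratio (hpos 0) hconv ?_ hρ fun n => ?_
    · simp [hcr]
    · have h1 := hρ n n le_rfl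
      have hq : 0 < r n - r (n + 1) := sub_pos.2 (hdec n)
      set ρ : ℝ := (((n : ℝ) + 2) / ((n : ℝ) + 1)) *
        ((r (n + 1) - r (n + 2)) / (r n - r (n + 1))) with hρdef
      have h2 : ρ * ((n + 1) * (r n - r (n + 1))) = (n + 2) * (r (n + 1) - r (n + 2)) := by
        have := hq.ne'
        rw [hρdef]
        field_simp
      have h3 := mul_nonneg (sub_nonneg.2 hc1.le) (sub_nonneg.2 h1)
      push_cast
      rw [show n + 1 + 1 = n + 2 from rfl]
      linarith
  have hA0 : ∀ n : ℕ, 0 ≤ ∑ kl ∈ antidiagonal n, coeff kl.1 D * r kl.2 := fun n =>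
    sum_nonneg fun kl _ => mul_nonneg (hd _) (hpos _).le
  have hAs : Summable fun n => ∑ kl ∈ antidiagonal n, coeff kl.1 D * r kl.2 := by
    refine summable_of_sum_range_le (c := |c|) hA0 fun N => ?_
    have h : ∑ n ∈ range N, ((n + 1) * r (n + 1) - n * r n) = N * r N := by
      simpa using sum_range_sub (fun n : ℕ => (n : ℝ) * r n) N
    simp_rw [hconv]
    rw [sum_sub_distrib, h, ← mul_sum]
    have h1 : ∑ n ∈ range N, r n ≤ 1 := hsum ▸ hrs.sum_le_tsum _ fun n _ => (hpos n).le
    have h2 : 0 ≤ ∑ n ∈ range N, r n := sum_nonneg fun n _ => (hpos n).le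
    have h3 : 0 ≤ (N : ℝ) * r N := mul_nonneg N.cast_nonneg (hpos N).le
    have h4 := mul_le_mul_of_nonneg_right (le_abs_self c) h2
    have h5 := mul_le_mul_of_nonneg_left h1 (abs_nonneg c)
    linarith
  have hds : Summable fun n => coeff n D := by
    refine summable_of_conv (fun n => (hpos n).le) (hpos 0) hd hAs fun n => ?_
    rw [← Nat.sum_antidiagonal_swap]
    exact sum_congr rfl fun kl _ => mul_comm _ _
  obtain ⟨h, hh, hgh⟩ := exists_nonneg_conv_binomThin ha0 ha1.le hpos hrs hd hds hconv
  have hrn : ∀ n, 0 ≤ r n := fun n => (hpos n).le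
  have hg := binomThin_nonneg ha0.le ha1.le hrn
  have hhs : Summable h :=
    summable_of_conv hg (binomThin_zero_pos ha0.le ha1.le hrs hrn (hpos 0)) hh hrs hgh
  have key : ∀ w ∈ Set.Icc (0 : ℝ) 1, ∑' n : ℕ, r n * w ^ n =
      (∑' n : ℕ, r n * (1 - a + a * w) ^ n) * ∑' m : ℕ, h m * w ^ m := by
    rintro w ⟨hw0, hw1⟩
    have hG := hasSum_binomThin_mul_pow ha0.le ha1.le hrs hrn hw0 hw1
    have hHs : Summable fun m => h m * w ^ m :=
      Summable.of_nonneg_of_le (fun m => mul_nonneg (hh m) (pow_nonneg hw0 m))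
        (fun m => mul_le_of_le_one_right (hh m) (pow_le_one₀ hw0 hw1)) hhs
    rw [← hG.tsum_eq, tsum_mul_tsum_eq_tsum_sum_antidiagonal_of_summable_norm hG.summable.norm
      hHs.norm]
    refine tsum_congr fun n => ?_
    rw [← hgh n, sum_mul]
    refine sum_congr rfl fun kl hkl => ?_
    rw [← mem_antidiagonal.1 hkl, pow_add]
    ring
  refine ⟨h, hh, ?_, key⟩
  have h1 := key 1 (by simp)
  simp only [mul_one, sub_add_cancel, one_pow, hsum, one_mul] at h1
  exact h1.symm
end

section
/- Let 0 < γ < 1 and define f(x) = -e^x Γ(-γ,x)/Γ(-γ) for x > 0, where Γ(-γ,x) = ∫_x^∞ t^{-γ-1} e^{-t} dt is the upper incomplete Gamma function and Γ(-γ) < 0 is the real Gamma function at -γ. Then f is a probability density on (0,∞) (f ≥ 0 and ∫_0^∞ f(x) dx = 1), and for all w ∈ (0,1) the shifted Sibuya probability generating function satisfies (1-(1-w)^γ)/w = ∫_0^∞ e^{-(1-w)x} f(x) dx. -/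
open MeasureTheory Set

lemma integrableOn_rpow_mul_exp_neg_Ioi (a : ℝ) {x : ℝ} (hx : 0 < x) :
    IntegrableOn (fun t : ℝ => t ^ a * Real.exp (-t)) (Ioi x) := by
  refine integrable_of_isBigO_exp_neg (b := 1 / 2) (by norm_num) ?_ ?_
  · refine ContinuousOn.mul (fun t ht => ?_) (by fun_prop)
    exact (Real.continuousAt_rpow_const t a (Or.inl (hx.trans_le ht).ne')).continuousWithinAt
  · simpa [mul_comm] using (Real.Gamma_integrand_isLittleO a).isBigO

/-- Tonelli's theorem on the wedge `0 < x < t`. -/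
lemma lintegral_Ioi_mul_lintegral_Ioi {u h : ℝ → ENNReal} (hu : Measurable u)
    (hh : Measurable h) :
    ∫⁻ x in Ioi (0 : ℝ), u x * ∫⁻ t in Ioi x, h t =
      ∫⁻ t in Ioi (0 : ℝ), h t * ∫⁻ x in Ioo 0 t, u x := by
  have hm : Measurable
      (fun p : ℝ × ℝ => {q : ℝ × ℝ | 0 < q.1 ∧ q.1 < q.2}.indicator
        (fun q => u q.1 * h q.2) p) :=
    ((hu.comp measurable_fst).mul (hh.comp measurable_snd)).indicator
      ((measurableSet_lt measurable_const measurable_fst).inter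
        (measurableSet_lt measurable_fst measurable_snd))
  have hswap := lintegral_lintegral_swap (μ := volume) (ν := volume)
    (f := fun x t : ℝ => {q : ℝ × ℝ | 0 < q.1 ∧ q.1 < q.2}.indicator
        (fun q => u q.1 * h q.2) (x, t)) hm.aemeasurable
  convert hswap using 1
  · rw [← lintegral_indicator measurableSet_Ioi]
    congr 1 with x
    by_cases hx : 0 < x
    · rw [indicator_of_mem (mem_Ioi.2 hx), ← lintegral_const_mul _ hh,
        ← lintegral_indicator measurableSet_Ioi]
      congr 1 with t
      simp [indicator, hx]
    · simp [indicator, hx]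
  · rw [← lintegral_indicator measurableSet_Ioi]
    congr 1 with t
    by_cases ht : 0 < t
    · rw [indicator_of_mem (mem_Ioi.2 ht), ← lintegral_const_mul _ hu,
        ← lintegral_indicator measurableSet_Ioo]
      congr 1 with x
      simp [indicator, mul_comm]
    · have : ∀ x, ¬ (0 < x ∧ x < t) := fun x hx => ht (hx.1.trans hx.2)
      simp [indicator, ht, this]

lemma ofReal_intervalIntegral_eq_lintegral {φ : ℝ → ℝ} {b : ℝ} (hb : 0 ≤ b)
    (hφ : IntervalIntegrable φ volume 0 b) (hpos : ∀ x ∈ Ioo 0 b, 0 ≤ φ x) :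
    ENNReal.ofReal (∫ x in (0 : ℝ)..b, φ x) = ∫⁻ x in Ioo 0 b, ENNReal.ofReal (φ x) := by
  rw [intervalIntegral.integral_of_le hb, integral_Ioc_eq_integral_Ioo,
    ofReal_integral_eq_lintegral_ofReal]
  · exact ((intervalIntegrable_iff_integrableOn_Ioc_of_le hb).1 hφ).mono_set Ioo_subset_Ioc_self
  · exact (ae_restrict_iff' measurableSet_Ioo).2 (.of_forall hpos)

lemma rpow_mul_exp_mul_integral_exp (γ w : ℝ) {t : ℝ} (ht : 0 < t) :
    t ^ (-γ - 1) * Real.exp (-t) * ∫ x in (0 : ℝ)..t, Real.exp (w * x) =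
      ∫ s in (0 : ℝ)..1, t ^ (-γ) * Real.exp (-((1 - w * s) * t)) := by
  have h := intervalIntegral.mul_integral_comp_mul_left (a := 0) (b := 1)
    (f := fun x => Real.exp (w * x)) t
  rw [mul_zero, mul_one] at h
  rw [← h, ← mul_assoc, ← intervalIntegral.integral_const_mul]
  congr 1 with s
  have hr : t ^ (-γ - 1) * t = t ^ (-γ) := by
    rw [← Real.rpow_add_one ht.ne']; ring_nf
  have he : Real.exp (-t) * Real.exp (w * (t * s)) = Real.exp (-((1 - w * s) * t)) := by
    rw [← Real.exp_add]; ring_nf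
  rw [← hr, ← he]; ring

lemma lintegral_rpow_neg_mul_exp_neg_mul {γ b : ℝ} (hγ : γ < 1) (hb : 0 < b) :
    ∫⁻ t in Ioi (0 : ℝ), ENNReal.ofReal (t ^ (-γ) * Real.exp (-(b * t))) =
      ENNReal.ofReal (Real.Gamma (1 - γ) * b ^ (γ - 1)) := by
  have hI := Real.integral_rpow_mul_exp_neg_mul_Ioi (a := 1 - γ) (r := b) (by linarith) hb
  rw [show 1 - γ - 1 = -γ by ring] at hI
  have hG := Real.Gamma_pos_of_pos (s := 1 - γ) (by linarith)
  have hval : (1 / b) ^ (1 - γ) * Real.Gamma (1 - γ) = Real.Gamma (1 - γ) * b ^ (γ - 1) := by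
    rw [one_div, Real.inv_rpow hb.le, ← Real.rpow_neg hb.le, neg_sub, mul_comm]
  rw [← hval, ← hI, ofReal_integral_eq_lintegral_ofReal]
  · refine Integrable.of_integral_ne_zero ?_
    rw [hI]; positivity
  · filter_upwards [ae_restrict_mem measurableSet_Ioi] with t ht
    have : (0 : ℝ) < t := ht
    positivity

lemma lintegral_one_sub_mul_rpow {γ w : ℝ} (hγ : 0 < γ) (hw : 0 < w) (hw1 : w ≤ 1) :
    ∫⁻ s in Ioo (0 : ℝ) 1, ENNReal.ofReal ((1 - w * s) ^ (γ - 1)) =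
      ENNReal.ofReal ((1 - (1 - w) ^ γ) / (γ * w)) := by
  have hint : IntervalIntegrable (fun s : ℝ => (1 - w * s) ^ (γ - 1)) volume 0 1 := by
    have h := ((intervalIntegral.intervalIntegrable_rpow' (a := 1) (b := 1 - w)
      (r := γ - 1) (by linarith)).comp_sub_left 1).comp_mul_left (c := w)
    simpa [hw.ne'] using h
  rw [← ofReal_intervalIntegral_eq_lintegral zero_le_one hint]
  · congr 1
    rw [intervalIntegral.integral_comp_sub_mul (fun x => x ^ (γ - 1)) hw.ne' 1,
      integral_rpow (Or.inl (by linarith))]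
    simp
    field_simp
  · intro s hs
    have : w * s ≤ 1 := by nlinarith [hs.1, hs.2]
    exact Real.rpow_nonneg (by linarith) _

/-- The Laplace-type transform of `x ↦ Γ(-γ, x)` on `(0, ∞)`. -/
lemma lintegral_exp_mul_incompleteGamma {γ w : ℝ} (hγ : 0 < γ) (hγ1 : γ < 1)
    (hw : 0 < w) (hw1 : w ≤ 1) :
    ∫⁻ x in Ioi (0 : ℝ), ENNReal.ofReal (Real.exp (w * x)) *
        ∫⁻ t in Ioi x, ENNReal.ofReal (t ^ (-γ - 1) * Real.exp (-t)) =
      ENNReal.ofReal (Real.Gamma (1 - γ) * ((1 - (1 - w) ^ γ) / (γ * w))) := by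
  rw [lintegral_Ioi_mul_lintegral_Ioi (by fun_prop) (by fun_prop)]
  have hinner : ∀ t ∈ Ioi (0 : ℝ), ENNReal.ofReal (t ^ (-γ - 1) * Real.exp (-t)) *
      ∫⁻ x in Ioo 0 t, ENNReal.ofReal (Real.exp (w * x)) =
      ∫⁻ s in Ioo (0 : ℝ) 1,
        ENNReal.ofReal (t ^ (-γ) * Real.exp (-((1 - w * s) * t))) := by
    intro t ht
    have ht : 0 < t := ht
    rw [← ofReal_intervalIntegral_eq_lintegral ht.le
        (Continuous.intervalIntegrable (by fun_prop) _ _) (fun x _ => by positivity),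
      ← ENNReal.ofReal_mul (by positivity), rpow_mul_exp_mul_integral_exp γ w ht,
      ofReal_intervalIntegral_eq_lintegral zero_le_one
        (Continuous.intervalIntegrable (by fun_prop) _ _) (fun x _ => by positivity)]
  rw [setLIntegral_congr_fun measurableSet_Ioi hinner, lintegral_lintegral_swap]
  · have hG := Real.Gamma_pos_of_pos (s := 1 - γ) (by linarith)
    rw [setLIntegral_congr_fun measurableSet_Ioo
      (g := fun s => ENNReal.ofReal (Real.Gamma (1 - γ)) *
        ENNReal.ofReal ((1 - w * s) ^ (γ - 1))),
      lintegral_const_mul _ (by fun_prop), lintegral_one_sub_mul_rpow hγ hw hw1,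
      ← ENNReal.ofReal_mul hG.le]
    intro s hs
    have hb : 0 < 1 - w * s := by nlinarith [hs.1, hs.2]
    simp only
    rw [lintegral_rpow_neg_mul_exp_neg_mul hγ1 hb, ENNReal.ofReal_mul hG.le]
  · exact Measurable.aemeasurable (by fun_prop)

lemma measurable_integral_Ioi {φ : ℝ → ℝ} (hφ : Measurable φ) :
    Measurable (fun x : ℝ => ∫ t in Ioi x, φ t) := by
  have hm : Measurable (fun p : ℝ × ℝ => {q : ℝ × ℝ | q.1 < q.2}.indicator
      (fun q => φ q.2) p) :=
    (hφ.comp measurable_snd).indicator (measurableSet_lt measurable_fst measurable_snd)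
  convert (hm.stronglyMeasurable.integral_prod_right' (ν := volume)).measurable using 2 with x
  rw [← integral_indicator measurableSet_Ioi]
  rfl

lemma integral_exp_mul_incompleteGamma {γ w : ℝ} (hγ : 0 < γ) (hγ1 : γ < 1)
    (hw : 0 < w) (hw1 : w ≤ 1) :
    ∫ x in Ioi (0 : ℝ), Real.exp (w * x) *
        ∫ t in Ioi x, t ^ (-γ - 1) * Real.exp (-t) =
      Real.Gamma (1 - γ) * ((1 - (1 - w) ^ γ) / (γ * w)) := by
  have hnn : ∀ x ∈ Ioi (0 : ℝ), ∀ t ∈ Ioi x, 0 ≤ t ^ (-γ - 1) * Real.exp (-t) := by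
    intro x hx t ht
    have : 0 < t := lt_trans hx ht
    positivity
  have hG := Real.Gamma_pos_of_pos (s := 1 - γ) (by linarith)
  have h1 : (1 - w) ^ γ ≤ 1 := Real.rpow_le_one (by linarith) (by linarith) hγ.le
  have h1' : 0 ≤ 1 - (1 - w) ^ γ := by linarith
  rw [integral_eq_lintegral_of_nonneg_ae]
  · rw [setLIntegral_congr_fun measurableSet_Ioi
      (g := fun x => ENNReal.ofReal (Real.exp (w * x)) *
        ∫⁻ t in Ioi x, ENNReal.ofReal (t ^ (-γ - 1) * Real.exp (-t))),
      lintegral_exp_mul_incompleteGamma hγ hγ1 hw hw1, ENNReal.toReal_ofReal (by positivity)]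
    intro x hx
    simp only
    rw [ENNReal.ofReal_mul (Real.exp_pos _).le, ofReal_integral_eq_lintegral_ofReal
      (integrableOn_rpow_mul_exp_neg_Ioi _ hx)
      ((ae_restrict_iff' measurableSet_Ioi).2 (.of_forall (hnn x hx)))]
  · filter_upwards [ae_restrict_mem measurableSet_Ioi] with x hx
    exact mul_nonneg (Real.exp_pos _).le (setIntegral_nonneg measurableSet_Ioi (hnn x hx))
  · exact (Measurable.mul (by fun_prop)
      (measurable_integral_Ioi (by fun_prop))).aestronglyMeasurable


/-- The mixing density of the shifted Sibuya distribution: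
`f(x) = -eˣ Γ(-γ,x)/Γ(-γ)` is a probability density on `(0,∞)` and the shifted
Sibuya pgf `(1-(1-w)^γ)/w` is its Laplace mixture. -/
theorem stmt_16 (γ : ℝ) (hγ : γ ∈ Set.Ioo (0:ℝ) 1)
    (f : ℝ → ℝ)
    (hf : ∀ x : ℝ, f x =
      -(Real.exp x * ∫ t in Set.Ioi x, t ^ (-γ - 1) * Real.exp (-t)) / Real.Gamma (-γ)) :
    (∀ x ∈ Set.Ioi (0:ℝ), 0 ≤ f x) ∧
    (∫ x in Set.Ioi (0:ℝ), f x = 1) ∧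
    (∀ w ∈ Set.Ioo (0:ℝ) 1,
      (1 - (1 - w) ^ γ) / w = ∫ x in Set.Ioi (0:ℝ), Real.exp (-(1 - w) * x) * f x) := by
  obtain ⟨hγ0, hγ1⟩ := hγ
  have hG := Real.Gamma_pos_of_pos (s := 1 - γ) (by linarith)
  have hrec : Real.Gamma (1 - γ) = -γ * Real.Gamma (-γ) := by
    rw [← Real.Gamma_add_one (by linarith : -γ ≠ 0)]; ring_nf
  have hneg : Real.Gamma (-γ) < 0 := by nlinarith
  have hmix : ∀ w : ℝ, 0 < w → w ≤ 1 →
      ∫ x in Set.Ioi (0:ℝ), Real.exp (-(1 - w) * x) * f x = (1 - (1 - w) ^ γ) / w := by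
    intro w hw hw1
    have heq : ∀ x, Real.exp (-(1 - w) * x) * f x = -(Real.Gamma (-γ))⁻¹ *
        (Real.exp (w * x) * ∫ t in Set.Ioi x, t ^ (-γ - 1) * Real.exp (-t)) := by
      intro x
      rw [hf, show w * x = -(1 - w) * x + x by ring, Real.exp_add]
      ring
    simp_rw [heq]
    rw [integral_const_mul, integral_exp_mul_incompleteGamma hγ0 hγ1 hw hw1, hrec]
    have := hneg.ne
    field_simp
  refine ⟨fun x hx => ?_, ?_, fun w hw => (hmix w hw.1 hw.2.le).symm⟩
  · rw [hf]
    refine div_nonneg_of_nonpos (neg_nonpos.2 (mul_nonneg (Real.exp_pos _).le ?_)) hneg.le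
    refine setIntegral_nonneg measurableSet_Ioi fun t ht => ?_
    have : 0 < t := lt_trans hx ht
    positivity
  · simpa [Real.zero_rpow hγ0.ne'] using hmix 1 one_pos le_rfl
end

section
/- Let 0 < γ < 1 and n ∈ ℕ, and let Γ(-γ,x) = ∫_x^∞ t^{-γ-1} e^{-t} dt denote the upper incomplete Gamma function. Then both integrals ∫_0^∞ x^n Γ(-γ,x) dx and ∫_0^∞ x^{n+1} Γ(-γ,x) dx are finite and ∫_0^∞ x^{n+1} Γ(-γ,x) dx = ((n+1)(n+1-γ)/(n+2)) · ∫_0^∞ x^n Γ(-γ,x) dx. Consequently the shifted Sibuya probability mass function r_n satisfies the one-step recurrence (n+1) r_{n+1}/r_n = (n+1)(n+1-γ)/(n+2). -/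
open MeasureTheory Set in
/-- The kernel whose iterated integrals give the moments of the upper incomplete Gamma function. -/
noncomputable def momentKernel (a : ℝ) (m : ℕ) (p : ℝ × ℝ) : ℝ :=
  {q : ℝ × ℝ | q.1 < q.2}.indicator
    (fun q => q.1 ^ m * (q.2 ^ (a - 1) * Real.exp (-q.2))) p

open MeasureTheory Set in
lemma momentKernel_fst_eq (a : ℝ) (m : ℕ) (t : ℝ) :
    (fun x => momentKernel a m (x, t)) =
      (Iio t).indicator (fun x => x ^ m * (t ^ (a - 1) * Real.exp (-t))) := by
  ext x
  simp [momentKernel, indicator]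

open MeasureTheory Set in
lemma momentKernel_snd_eq (a : ℝ) (m : ℕ) (x : ℝ) :
    (fun t => momentKernel a m (x, t)) =
      (Ioi x).indicator (fun t => x ^ m * (t ^ (a - 1) * Real.exp (-t))) := by
  ext t
  simp [momentKernel, indicator]

open MeasureTheory Set in
lemma integral_momentKernel_fst (a : ℝ) (m : ℕ) {t : ℝ} (ht : 0 < t) :
    ∫ x in Ioi (0 : ℝ), momentKernel a m (x, t) =
      (1 / ((m : ℝ) + 1)) * (Real.exp (-t) * t ^ (a + m + 1 - 1)) := by
  rw [momentKernel_fst_eq, setIntegral_indicator measurableSet_Iio, Ioi_inter_Iio,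
    ← integral_Ioc_eq_integral_Ioo, ← intervalIntegral.integral_of_le ht.le,
    intervalIntegral.integral_mul_const, integral_pow]
  have h : t ^ (a + m + 1 - 1) = t ^ (m + 1) * t ^ (a - 1) := by
    rw [← Real.rpow_natCast, ← Real.rpow_add ht]
    congr 1
    push_cast
    ring
  rw [h]
  simp
  ring

open MeasureTheory Set in
lemma integral_momentKernel_snd (a : ℝ) (m : ℕ) {x : ℝ} (hx : 0 < x) :
    ∫ t in Ioi (0 : ℝ), momentKernel a m (x, t) =
      x ^ m * ∫ t in Ioi x, t ^ (a - 1) * Real.exp (-t) := by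
  rw [momentKernel_snd_eq, setIntegral_indicator measurableSet_Ioi, Ioi_inter_Ioi,
    sup_eq_right.mpr hx.le, integral_const_mul]

open MeasureTheory Set in
lemma integrable_momentKernel {a : ℝ} {m : ℕ} (ha : 0 < a + m + 1) :
    Integrable (momentKernel a m)
      ((volume.restrict (Ioi (0 : ℝ))).prod (volume.restrict (Ioi (0 : ℝ)))) := by
  have hmeas : Measurable (momentKernel a m) := by
    refine Measurable.indicator ?_ (measurableSet_lt measurable_fst measurable_snd)
    fun_prop
  rw [integrable_prod_iff' hmeas.aestronglyMeasurable]
  constructor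
  · filter_upwards [ae_restrict_mem measurableSet_Ioi] with t ht
    rw [momentKernel_fst_eq, integrable_indicator_iff measurableSet_Iio, IntegrableOn,
      Measure.restrict_restrict measurableSet_Iio, Iio_inter_Ioi]
    refine IntegrableOn.mono_set ?_ Ioo_subset_Icc_self
    exact Continuous.integrableOn_Icc (by fun_prop)
  · refine ((Real.GammaIntegral_convergent ha).const_mul (1 / ((m : ℝ) + 1))).congr ?_
    filter_upwards [ae_restrict_mem measurableSet_Ioi] with t ht
    rw [← integral_momentKernel_fst a m ht]
    refine setIntegral_congr_fun measurableSet_Ioi fun x hx => ?_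
    refine (Real.norm_of_nonneg (indicator_apply_nonneg fun _ => ?_)).symm
    have hx' : (0 : ℝ) < x := hx
    have ht' : (0 : ℝ) < t := ht
    positivity

open MeasureTheory Set in
/-- Moments of the upper incomplete Gamma function `x ↦ Γ(a, x)` are finite. -/
theorem integrableOn_pow_mul_upperGamma {a : ℝ} {m : ℕ} (ha : 0 < a + m + 1) :
    IntegrableOn (fun x : ℝ => x ^ m * ∫ t in Ioi x, t ^ (a - 1) * Real.exp (-t))
      (Ioi 0) := by
  refine (integrable_momentKernel ha).integral_prod_left.congr ?_
  filter_upwards [ae_restrict_mem measurableSet_Ioi] with x hx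
  exact integral_momentKernel_snd a m hx

open MeasureTheory Set in
/-- Moments of the upper incomplete Gamma function `x ↦ Γ(a, x)` in closed form. -/
theorem integral_pow_mul_upperGamma {a : ℝ} {m : ℕ} (ha : 0 < a + m + 1) :
    ∫ x in Ioi (0 : ℝ), x ^ m * ∫ t in Ioi x, t ^ (a - 1) * Real.exp (-t) =
      Real.Gamma (a + m + 1) / ((m : ℝ) + 1) := by
  calc
    _ = ∫ x in Ioi (0 : ℝ), ∫ t in Ioi (0 : ℝ), momentKernel a m (x, t) :=
      setIntegral_congr_fun measurableSet_Ioi fun x hx =>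
        (integral_momentKernel_snd a m hx).symm
    _ = ∫ t in Ioi (0 : ℝ), ∫ x in Ioi (0 : ℝ), momentKernel a m (x, t) :=
      integral_integral_swap (f := fun x t => momentKernel a m (x, t))
        (integrable_momentKernel ha)
    _ = ∫ t in Ioi (0 : ℝ), (1 / ((m : ℝ) + 1)) * (Real.exp (-t) * t ^ (a + m + 1 - 1)) :=
      setIntegral_congr_fun measurableSet_Ioi fun t ht => integral_momentKernel_fst a m ht
    _ = _ := by
      rw [integral_const_mul, ← Real.Gamma_eq_integral ha]
      ring


/-- Moment identity for the upper incomplete Gamma function, and the resulting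
one-step recurrence of the shifted Sibuya pmf. -/
theorem stmt_17 (γ : ℝ) (hγ : γ ∈ Set.Ioo (0:ℝ) 1) (n : ℕ)
    (G : ℝ → ℝ) (hG : ∀ x : ℝ, G x = ∫ t in Set.Ioi x, t ^ (-γ - 1) * Real.exp (-t))
    (f : ℝ → ℝ) (hf : ∀ x : ℝ, f x = -(Real.exp x * G x) / Real.Gamma (-γ))
    (r : ℕ → ℝ)
    (hr : ∀ m : ℕ, r m =
      (1 / (m.factorial : ℝ)) * ∫ x in Set.Ioi (0:ℝ), Real.exp (-x) * x ^ m * f x) :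
    MeasureTheory.IntegrableOn (fun x => x ^ n * G x) (Set.Ioi 0) ∧
    MeasureTheory.IntegrableOn (fun x => x ^ (n + 1) * G x) (Set.Ioi 0) ∧
    (∫ x in Set.Ioi (0:ℝ), x ^ (n + 1) * G x =
      (((n : ℝ) + 1) * ((n : ℝ) + 1 - γ) / ((n : ℝ) + 2)) *
        ∫ x in Set.Ioi (0:ℝ), x ^ n * G x) ∧
    ((n : ℝ) + 1) * r (n + 1) / r n =
      ((n : ℝ) + 1) * ((n : ℝ) + 1 - γ) / ((n : ℝ) + 2) := by
  obtain ⟨h0, h1⟩ := hγ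
  obtain rfl : G = fun x => ∫ t in Set.Ioi x, t ^ (-γ - 1) * Real.exp (-t) := funext hG
  have hpos : ∀ m : ℕ, 0 < -γ + m + 1 := fun m => by
    have : (0 : ℝ) ≤ m := m.cast_nonneg
    linarith
  have hn : (0 : ℝ) ≤ n := n.cast_nonneg
  have hΓ := Real.Gamma_pos_of_pos (hpos n)
  have hrec : Real.Gamma (-γ + (n + 1 : ℕ) + 1) =
      ((n : ℝ) + 1 - γ) * Real.Gamma (-γ + n + 1) := by
    have h := Real.Gamma_add_one (hpos n).ne'
    push_cast
    rw [← add_assoc, h]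
    ring
  have hmoment := fun m : ℕ => integral_pow_mul_upperGamma (hpos m)
  have hr' : ∀ m : ℕ, r m = (1 / (m.factorial : ℝ)) *
      ((-1 / Real.Gamma (-γ)) * (Real.Gamma (-γ + m + 1) / ((m : ℝ) + 1))) := fun m => by
    rw [hr m, ← hmoment m, ← MeasureTheory.integral_const_mul (-1 / Real.Gamma (-γ))]
    congr 1
    refine MeasureTheory.integral_congr_ae (.of_forall fun x => ?_)
    dsimp only
    rw [hf x, Real.exp_neg]
    field_simp
  have hΓγ : Real.Gamma (-γ) ≠ 0 := Real.Gamma_ne_zero fun m hm => by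
    have hm' : γ = m := neg_injective hm
    rw [hm'] at h0 h1
    norm_cast at h0 h1
    omega
  refine ⟨integrableOn_pow_mul_upperGamma (hpos n),
    integrableOn_pow_mul_upperGamma (hpos (n + 1)), ?_, ?_⟩
  · rw [hmoment, hmoment, hrec]
    push_cast
    field_simp
    ring
  · have hfac : (n.factorial : ℝ) ≠ 0 := by positivity
    rw [hr', hr', hrec, Nat.factorial_succ]
    push_cast
    field_simp
    ring
end

section
/- Let 0 < r < γ < 1 and define f(x) = -e^x Γ(-γ,x)/Γ(-γ) for x > 0, where Γ(-γ,x) = ∫_x^∞ t^{-γ-1} e^{-t} dt and Γ(-γ) is the real Gamma function at -γ. Then ∫_0^∞ x^r f(x) dx = sin(πγ) Γ(r+1) / sin(π(γ-r)); in particular the r-th moment of f is finite for 0 < r < γ (while it diverges for r > γ). -/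
open MeasureTheory Set

/-- The Gamma integral `∫₀^∞ t^(a-1) e^(-bt) dt = b^(-a) Γ(a)` as a Lebesgue integral. -/
lemma lintegral_rpow_mul_exp_neg_mul_Ioi {a b : ℝ} (ha : 0 < a) (hb : 0 < b) :
    ∫⁻ t in Ioi (0 : ℝ), ENNReal.ofReal (t ^ (a - 1) * Real.exp (-(b * t))) =
      ENNReal.ofReal ((1 / b) ^ a * Real.Gamma a) := by
  rw [← Real.integral_rpow_mul_exp_neg_mul_Ioi ha hb, ofReal_integral_eq_lintegral_ofReal]
  · have h := integrableOn_rpow_mul_exp_neg_mul_rpow (s := a - 1) (by linarith) one_pos hb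
    simpa [IntegrableOn] using h
  · filter_upwards [self_mem_ae_restrict measurableSet_Ioi] with t ht
    have : (0 : ℝ) < t := ht
    simp only [Pi.zero_apply]
    positivity

/-- The Beta integral of the second kind,
`∫₀^∞ x^(a-1) (x+w)^(-(a+b)) dx = w^(-b) Γ(a) Γ(b) / Γ(a+b)`. -/
lemma lintegral_rpow_mul_add_rpow_neg_Ioi {a b w : ℝ} (ha : 0 < a) (hb : 0 < b) (hw : 0 < w) :
    ∫⁻ x in Ioi (0 : ℝ), ENNReal.ofReal (x ^ (a - 1) * (x + w) ^ (-(a + b))) =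
      ENNReal.ofReal (w ^ (-b) * (Real.Gamma a * Real.Gamma b / Real.Gamma (a + b))) := by
  have hΓa := Real.Gamma_pos_of_pos ha
  have hΓb := Real.Gamma_pos_of_pos hb
  have hΓ := Real.Gamma_pos_of_pos (add_pos ha hb)
  calc
    _ = ∫⁻ x in Ioi (0 : ℝ), ∫⁻ s in Ioi (0 : ℝ),
          ENNReal.ofReal (x ^ (a - 1) / Real.Gamma (a + b)) *
            ENNReal.ofReal (s ^ (a + b - 1) * Real.exp (-((x + w) * s))) := by
      refine setLIntegral_congr_fun measurableSet_Ioi fun x (hx : 0 < x) => ?_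
      have hxw : 0 < x + w := by positivity
      rw [lintegral_const_mul _ (by fun_prop),
        lintegral_rpow_mul_exp_neg_mul_Ioi (add_pos ha hb) hxw, ← ENNReal.ofReal_mul (by positivity),
        one_div, Real.inv_rpow hxw.le, ← Real.rpow_neg hxw.le]
      congr 1
      field_simp
    _ = ∫⁻ s in Ioi (0 : ℝ), ∫⁻ x in Ioi (0 : ℝ),
          ENNReal.ofReal (x ^ (a - 1) / Real.Gamma (a + b)) *
            ENNReal.ofReal (s ^ (a + b - 1) * Real.exp (-((x + w) * s))) :=
      lintegral_lintegral_swap (by fun_prop)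
    _ = ∫⁻ s in Ioi (0 : ℝ), ENNReal.ofReal (Real.Gamma a / Real.Gamma (a + b)) *
          ENNReal.ofReal (s ^ (b - 1) * Real.exp (-(w * s))) := by
      refine setLIntegral_congr_fun measurableSet_Ioi fun s (hs : 0 < s) => ?_
      calc
        _ = ∫⁻ x in Ioi (0 : ℝ),
              ENNReal.ofReal (s ^ (a + b - 1) * Real.exp (-(w * s)) / Real.Gamma (a + b)) *
                ENNReal.ofReal (x ^ (a - 1) * Real.exp (-(s * x))) := by
          refine setLIntegral_congr_fun measurableSet_Ioi fun x (hx : 0 < x) => ?_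
          rw [← ENNReal.ofReal_mul (by positivity), ← ENNReal.ofReal_mul (by positivity),
            show -((x + w) * s) = -(w * s) + -(s * x) by ring, Real.exp_add]
          congr 1
          ring
        _ = _ := by
          rw [lintegral_const_mul _ (by fun_prop), lintegral_rpow_mul_exp_neg_mul_Ioi ha hs,
            ← ENNReal.ofReal_mul (by positivity), ← ENNReal.ofReal_mul (by positivity),
            show a + b - 1 = (b - 1) + a by ring, Real.rpow_add hs, one_div, Real.inv_rpow hs.le]
          congr 1
          field_simp
    _ = _ := by
      rw [lintegral_const_mul _ (by fun_prop), lintegral_rpow_mul_exp_neg_mul_Ioi hb hw,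
        ← ENNReal.ofReal_mul (by positivity), one_div, Real.inv_rpow hw.le, ← Real.rpow_neg hw.le]
      congr 1
      ring

/-- The scaled upper incomplete Gamma function `eˣ Γ(1-c,x)` is the integral of
`(x+w)^(-c) e^(-w)` over `w > 0`. -/
lemma exp_mul_integral_Ioi_rpow_mul_exp_neg (c x : ℝ) :
    Real.exp x * ∫ t in Ioi x, t ^ (-c) * Real.exp (-t) =
      ∫ w in Ioi (0 : ℝ), (x + w) ^ (-c) * Real.exp (-w) := by
  have h := (measurePreserving_add_left volume x).setIntegral_preimage_emb
    (measurableEmbedding_addLeft x) (fun t : ℝ => t ^ (-c) * Real.exp (-t)) (Ioi x)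
  rw [← h, ← integral_const_mul]
  simp only [preimage_const_add_Ioi, sub_self]
  congr 1 with w
  rw [mul_left_comm, ← Real.exp_add]
  ring_nf

lemma integrableOn_add_rpow_neg_mul_exp_neg {c x : ℝ} (hc : 0 < c) (hx : 0 < x) :
    IntegrableOn (fun w => (x + w) ^ (-c) * Real.exp (-w)) (Ioi 0) := by
  refine Integrable.mono' ((integrableOn_exp_neg_Ioi 0).const_mul (x ^ (-c)))
    (by fun_prop) ?_
  filter_upwards [self_mem_ae_restrict measurableSet_Ioi] with w hw
  have hw : (0 : ℝ) < w := hw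
  rw [Real.norm_of_nonneg (by positivity)]
  exact mul_le_mul_of_nonneg_right
    (Real.rpow_le_rpow_of_nonpos hx (by linarith) (by linarith)) (by positivity)

/-- The Mellin transform of `∫₀^∞ (x+w)^(-(a+b)) e^(-w) dw` at `a`, as a Lebesgue integral. -/
lemma lintegral_rpow_mul_integral_add_rpow_neg {a b : ℝ} (ha : 0 < a) (hb : 0 < b) (hb1 : b < 1) :
    ∫⁻ x in Ioi (0 : ℝ), ENNReal.ofReal
        (x ^ (a - 1) * ∫ w in Ioi (0 : ℝ), (x + w) ^ (-(a + b)) * Real.exp (-w)) =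
      ENNReal.ofReal
        (Real.Gamma a * Real.Gamma b / Real.Gamma (a + b) * Real.Gamma (1 - b)) := by
  have hΓa := Real.Gamma_pos_of_pos ha
  have hΓb := Real.Gamma_pos_of_pos hb
  have hΓ := Real.Gamma_pos_of_pos (add_pos ha hb)
  calc
    _ = ∫⁻ x in Ioi (0 : ℝ), ∫⁻ w in Ioi (0 : ℝ), ENNReal.ofReal (Real.exp (-w)) *
          ENNReal.ofReal (x ^ (a - 1) * (x + w) ^ (-(a + b))) := by
      refine setLIntegral_congr_fun measurableSet_Ioi fun x (hx : 0 < x) => ?_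
      rw [← integral_const_mul, ofReal_integral_eq_lintegral_ofReal]
      · refine setLIntegral_congr_fun measurableSet_Ioi fun w (hw : 0 < w) => ?_
        rw [← ENNReal.ofReal_mul (by positivity)]
        congr 1
        ring
      · exact (integrableOn_add_rpow_neg_mul_exp_neg (add_pos ha hb) hx).const_mul _
      · filter_upwards [self_mem_ae_restrict measurableSet_Ioi] with w hw
        have : (0 : ℝ) < w := hw
        simp only [Pi.zero_apply]
        positivity
    _ = ∫⁻ w in Ioi (0 : ℝ), ∫⁻ x in Ioi (0 : ℝ), ENNReal.ofReal (Real.exp (-w)) *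
          ENNReal.ofReal (x ^ (a - 1) * (x + w) ^ (-(a + b))) :=
      lintegral_lintegral_swap (by fun_prop)
    _ = ∫⁻ w in Ioi (0 : ℝ),
          ENNReal.ofReal (Real.Gamma a * Real.Gamma b / Real.Gamma (a + b)) *
            ENNReal.ofReal (w ^ (1 - b - 1) * Real.exp (-(1 * w))) := by
      refine setLIntegral_congr_fun measurableSet_Ioi fun w (hw : 0 < w) => ?_
      rw [lintegral_const_mul _ (by fun_prop), lintegral_rpow_mul_add_rpow_neg_Ioi ha hb hw,
        ← ENNReal.ofReal_mul (by positivity), ← ENNReal.ofReal_mul (by positivity),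
        show 1 - b - 1 = -b by ring, one_mul]
      congr 1
      ring
    _ = _ := by
      rw [lintegral_const_mul _ (by fun_prop),
        lintegral_rpow_mul_exp_neg_mul_Ioi (sub_pos.2 hb1) one_pos,
        ← ENNReal.ofReal_mul (by positivity)]
      simp

/-- The Mellin transform of `∫₀^∞ (x+w)^(-(a+b)) e^(-w) dw` at `a`. -/
lemma integral_rpow_mul_integral_add_rpow_neg {a b : ℝ} (ha : 0 < a) (hb : 0 < b) (hb1 : b < 1) :
    IntegrableOn (fun x =>
        x ^ (a - 1) * ∫ w in Ioi (0 : ℝ), (x + w) ^ (-(a + b)) * Real.exp (-w)) (Ioi 0) ∧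
    ∫ x in Ioi (0 : ℝ),
        x ^ (a - 1) * ∫ w in Ioi (0 : ℝ), (x + w) ^ (-(a + b)) * Real.exp (-w) =
      Real.Gamma a * Real.Gamma b / Real.Gamma (a + b) * Real.Gamma (1 - b) := by
  have h := lintegral_rpow_mul_integral_add_rpow_neg ha hb hb1
  have hmeas : AEStronglyMeasurable (fun x : ℝ =>
      x ^ (a - 1) * ∫ w in Ioi (0 : ℝ), (x + w) ^ (-(a + b)) * Real.exp (-w))
      (volume.restrict (Ioi 0)) := by
    have hg : StronglyMeasurable fun x : ℝ =>
        ∫ w in Ioi (0 : ℝ), (x + w) ^ (-(a + b)) * Real.exp (-w) :=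
      StronglyMeasurable.integral_prod_right
        (Measurable.stronglyMeasurable (by unfold Function.uncurry; fun_prop))
    exact AEStronglyMeasurable.mul (by fun_prop) hg.aestronglyMeasurable
  have hnonneg : 0 ≤ᵐ[volume.restrict (Ioi 0)] fun x : ℝ =>
      x ^ (a - 1) * ∫ w in Ioi (0 : ℝ), (x + w) ^ (-(a + b)) * Real.exp (-w) := by
    filter_upwards [self_mem_ae_restrict measurableSet_Ioi] with x hx
    have hx : (0 : ℝ) < x := hx
    refine mul_nonneg (by positivity) (setIntegral_nonneg measurableSet_Ioi fun w hw => ?_)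
    have hw : (0 : ℝ) < w := hw
    positivity
  refine ⟨(lintegral_ofReal_ne_top_iff_integrable hmeas hnonneg).1 (h ▸ ENNReal.ofReal_ne_top), ?_⟩
  have hΓa := Real.Gamma_pos_of_pos ha
  have hΓb := Real.Gamma_pos_of_pos hb
  have hΓ := Real.Gamma_pos_of_pos (add_pos ha hb)
  have hΓ1 := Real.Gamma_pos_of_pos (sub_pos.2 hb1)
  rw [integral_eq_lintegral_of_nonneg_ae hnonneg hmeas, h, ENNReal.toReal_ofReal (by positivity)]


/-- The `r`-th moment (`0 < r < γ`) of the shifted Sibuya mixing density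
`f(x) = -eˣ Γ(-γ,x)/Γ(-γ)` equals `sin(πγ) Γ(r+1) / sin(π(γ-r))`. -/
theorem stmt_18 (r γ : ℝ) (hr : 0 < r) (hrγ : r < γ) (hγ : γ < 1)
    (f : ℝ → ℝ)
    (hf : ∀ x : ℝ, f x =
      -(Real.exp x * ∫ t in Set.Ioi x, t ^ (-γ - 1) * Real.exp (-t)) / Real.Gamma (-γ)) :
    MeasureTheory.IntegrableOn (fun x => x ^ r * f x) (Set.Ioi 0) ∧
    ∫ x in Set.Ioi (0:ℝ), x ^ r * f x =
      Real.sin (Real.pi * γ) * Real.Gamma (r + 1) / Real.sin (Real.pi * (γ - r)) := by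
  have hform : (fun x => x ^ r * f x) = fun x => (-Real.Gamma (-γ))⁻¹ *
      (x ^ (r + 1 - 1) *
        ∫ w in Ioi (0 : ℝ), (x + w) ^ (-(r + 1 + (γ - r))) * Real.exp (-w)) := by
    funext x
    rw [hf, ← exp_mul_integral_Ioi_rpow_mul_exp_neg, show -(r + 1 + (γ - r)) = -γ - 1 by ring,
      add_sub_cancel_right, inv_neg]
    ring
  obtain ⟨hint, hval⟩ := integral_rpow_mul_integral_add_rpow_neg (a := r + 1) (b := γ - r)
    (by linarith) (by linarith) (by linarith)
  rw [hform]
  refine ⟨hint.const_mul _, ?_⟩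
  rw [integral_const_mul, hval, show r + 1 + (γ - r) = γ + 1 by ring]
  have hsin : 0 < Real.sin (Real.pi * γ) :=
    Real.sin_pos_of_pos_of_lt_pi (by have := Real.pi_pos; nlinarith) (by nlinarith [Real.pi_pos])
  have hsin' : 0 < Real.sin (Real.pi * (γ - r)) :=
    Real.sin_pos_of_pos_of_lt_pi (mul_pos Real.pi_pos (by linarith)) (by nlinarith [Real.pi_pos])
  have h₁ := Real.Gamma_mul_Gamma_one_sub (γ - r)
  have h₂ := Real.Gamma_mul_Gamma_one_sub (-γ)
  rw [mul_neg, Real.sin_neg, show 1 - -γ = γ + 1 by ring] at h₂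
  have hπ := Real.pi_ne_zero
  have h₃ : -Real.Gamma (-γ) * Real.Gamma (γ + 1) = Real.pi / Real.sin (Real.pi * γ) := by
    rw [neg_mul, h₂, div_neg, neg_neg]
  calc
    _ = Real.Gamma (r + 1) * (Real.Gamma (γ - r) * Real.Gamma (1 - (γ - r))) /
          (-Real.Gamma (-γ) * Real.Gamma (γ + 1)) := by
      rw [div_mul_eq_mul_div, inv_mul_eq_div, div_div, mul_comm (Real.Gamma (γ + 1)), mul_assoc]
    _ = _ := by
      rw [h₁, h₃]
      field_simp
end

section
/- Let b ∈ (0,1] and γ ∈ (0,1), set c = 1-(1-b)^γ, let Q(w) = (1-(1-bw)^γ)/c be the extended Sibuya probability generating function, and define H(u) = u·b / (1-(1-uc)^{1/γ}) for u ∈ (0,1]. Then for every w ∈ (0,1] the fixed-point (progeny) equation Q(w) = w · H(Q(w)) holds; i.e. H is the offspring generating function whose Galton–Watson total progeny has pgf Q. -/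
/-- The extended Sibuya pgf `Q` satisfies the total-progeny fixed-point equation
`Q(w) = w · H(Q(w))` with offspring generating function
`H(u) = ub/(1-(1-uc)^{1/γ})`. -/
theorem stmt_19 (b γ : ℝ) (hb : b ∈ Set.Ioc (0:ℝ) 1) (hγ : γ ∈ Set.Ioo (0:ℝ) 1)
    (c : ℝ) (hc : c = 1 - (1 - b) ^ γ)
    (Q H : ℝ → ℝ)
    (hQ : ∀ w : ℝ, Q w = (1 - (1 - b * w) ^ γ) / c)
    (hH : ∀ u : ℝ, H u = u * b / (1 - (1 - u * c) ^ (1 / γ))) :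
    ∀ w ∈ Set.Ioc (0:ℝ) 1, Q w = w * H (Q w) := by
  rintro w ⟨hw0, hw1⟩
  obtain ⟨hb0, hb1⟩ := hb
  obtain ⟨hγ0, -⟩ := hγ
  have hc0 : c ≠ 0 := by
    have := Real.rpow_lt_one (sub_nonneg.2 hb1) (sub_lt_self 1 hb0) hγ0
    rw [hc]
    exact (sub_pos.2 this).ne'
  have hbw : 0 ≤ 1 - b * w := sub_nonneg.2 (mul_le_one₀ hb1 hw0.le hw1)
  have hinv : (1 - Q w * c) ^ (1 / γ) = 1 - b * w := by
    rw [hQ, div_mul_cancel₀ _ hc0, sub_sub_cancel, one_div, Real.rpow_rpow_inv hbw hγ0.ne']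
  rw [hH, hinv, sub_sub_cancel]
  field_simp
end
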